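/- arXiv:2312.11185 — 2 statements merged into one kernel-verified Lean document; each statement's English description precedes it below -/
import Mathlib

section
/- Let (μ,a) be an FS-pair such that μ ≥ 0 is ℕ-valued (i.e. μ = Σ_{γ∈Λ} m(γ) δ_γ with Λ ⊂ ℝ locally finite and each m(γ) a positive integer), the support of a is locally finite, and a has exponential growth. Then there exists a trigonometric polynomial Q, real-valued on ℝ and having only real zeros, such that μ = Σ_{Q(γ)=0} m_Q(γ) δ_γ, where m_Q(γ) denotes the multiplicity of the zero γ of Q. -/
open MeasureTheory Complex Filter Topology Set
open scoped ENNReal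

noncomputable section

/-- The open upper half-plane, as a subset of `ℂ`. -/
def UHP : Set ℂ := {z : ℂ | 0 < z.im}

/-- A relatively dense subset of `ℝ`. -/
def RelDense (τ : Set ℝ) : Prop := ∃ l > (0:ℝ), ∀ x : ℝ, ∃ t ∈ τ, x < t ∧ t < x + l

/-- Bohr almost periodic continuous functions on `ℝ`. -/
def APR (f : ℝ → ℂ) : Prop :=
  Continuous f ∧ ∀ ε > (0:ℝ), RelDense {t : ℝ | ∀ x : ℝ, ‖f x - f (x + t)‖ ≤ ε}

/-- Holomorphic almost periodic functions on the upper half-plane. -/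
def APH (f : ℂ → ℂ) : Prop :=
  DifferentiableOn ℂ f UHP ∧
  ∀ α β ε : ℝ, 0 < α → α < β → 0 < ε →
    ∃ τ : Set ℝ, RelDense τ ∧
      ∀ t ∈ τ, ∀ z : ℂ, α < z.im → z.im < β → ‖f z - f (z + (t : ℂ))‖ ≤ ε

/-- `HasMeanAt f y lam c` : the mean `(1/2T)∫_{-T+iy}^{T+iy} f(z) e^{-2πiλz} dz` tends to `c`. -/
def HasMeanAt (f : ℂ → ℂ) (y lam : ℝ) (c : ℂ) : Prop :=
  Tendsto (fun T : ℝ => (1 / (2 * (T : ℂ))) *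
      ∫ x in (-T)..T, f ((x : ℂ) + (y : ℂ) * Complex.I) *
        Complex.exp (-(2 * (Real.pi : ℂ) * Complex.I * (lam : ℂ) * ((x : ℂ) + (y : ℂ) * Complex.I))))
    atTop (𝓝 c)

/-- `HasMeanR f lam c` : the Bohr mean `(1/2T)∫_{-T}^{T} f(x) e^{-2πiλx} dx` tends to `c`. -/
def HasMeanR (f : ℝ → ℂ) (lam : ℝ) (c : ℂ) : Prop :=
  Tendsto (fun T : ℝ => (1 / (2 * (T : ℂ))) *
      ∫ x in (-T)..T, f x *
        Complex.exp (-(2 * (Real.pi : ℂ) * Complex.I * (lam : ℂ) * (x : ℂ))))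
    atTop (𝓝 c)

/-- The spectrum of a function on the upper half-plane: frequencies where the mean is not `0`. -/
def specH (f : ℂ → ℂ) : Set ℝ := {lam : ℝ | ∃ y > (0:ℝ), ¬ HasMeanAt f y lam 0}

/-- A locally finite subset of `ℝ`. -/
def LocFinSet (S : Set ℝ) : Prop := ∀ a b : ℝ, (S ∩ Set.Ioo a b).Finite

/-- A uniformly discrete subset of `ℝ`. -/
def UnifDiscrete (S : Set ℝ) : Prop :=
  ∃ d > (0:ℝ), ∀ x ∈ S, ∀ y ∈ S, x ≠ y → d ≤ |x - y|

/-- Locally summable coefficient functions. -/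
def LocSummable (a : ℝ → ℂ) : Prop :=
  (Function.support a).Countable ∧
  ∀ T > (0:ℝ), Summable (Set.indicator (Set.Icc (-T) T) fun l => ‖a l‖)

/-- Exponential growth of a coefficient function. -/
def ExpGrowth (a : ℝ → ℂ) : Prop :=
  ∃ c > (0:ℝ), Summable fun lam : ℝ => ‖a lam‖ * Real.exp (-c * |lam|)

/-- `a(-λ) = conj (a(λ))`. -/
def Antipodal (a : ℝ → ℂ) : Prop := ∀ lam : ℝ, a (-lam) = (starRingEnd ℂ) (a lam)

/-- The Fourier transform `φ̂(ξ) = ∫ φ(x) e^{-2πixξ} dx`. -/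
def FT (φ : ℝ → ℂ) (ξ : ℝ) : ℂ :=
  ∫ x : ℝ, φ x * Complex.exp (-(2 * (Real.pi : ℂ) * Complex.I * (x : ℂ) * (ξ : ℂ)))

/-- A complex-valued measure on `ℝ`, encoded by its total variation `ν` together with a
unimodular density `w`, so that `dμ = w dν` and `|μ| = ν`. -/
structure CMeasure where
  ν : Measure ℝ
  w : ℝ → ℂ
  meas : Measurable w
  unit : ∀ᵐ t ∂ν, ‖w t‖ = 1

/-- Integration against a complex measure. -/
def CMeasure.integral (μ : CMeasure) (φ : ℝ → ℂ) : ℂ := ∫ t, φ t * μ.w t ∂μ.ν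

/-- Strongly tempered: every Schwartz function is `|μ|`-integrable. -/
def CMeasure.IsStronglyTempered (μ : CMeasure) : Prop :=
  ∀ φ : SchwartzMap ℝ ℂ, Integrable (fun t => φ t) μ.ν

/-- Real-valued complex measure. -/
def CMeasure.RealValued (μ : CMeasure) : Prop := ∀ᵐ t ∂μ.ν, (μ.w t).im = 0

/-- Nonnegative complex measure. -/
def CMeasure.Nonneg (μ : CMeasure) : Prop := ∀ᵐ t ∂μ.ν, μ.w t = 1

/-- `deg(μ) ≤ n` : `∫ (1+t²)^{-n/2} d|μ| < ∞`. -/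
def CMeasure.DegLE (μ : CMeasure) (n : ℕ) : Prop :=
  Integrable (fun t : ℝ => (1 + t ^ 2) ^ (-(n : ℝ) / 2)) μ.ν

/-- The mass `μ({x})` of an atom. -/
def CMeasure.atom (μ : CMeasure) (x : ℝ) : ℂ := ∫ t in {x}, μ.w t ∂μ.ν

/-- The (closed) support of a measure on `ℝ`. -/
def measSupport (ν : Measure ℝ) : Set ℝ := {x : ℝ | ∀ U ∈ 𝓝 x, ν U ≠ 0}

/-- `(μ, a)` is a Fourier summation pair. -/
def IsFSPair (μ : CMeasure) (a : ℝ → ℂ) : Prop :=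
  μ.IsStronglyTempered ∧ LocSummable a ∧
    ∀ φ : ℝ → ℂ, ContDiff ℝ (⊤ : ℕ∞) φ → HasCompactSupport φ →
      μ.integral (FT φ) = ∑' lam : ℝ, a lam * φ lam

/-- Trigonometric polynomials. -/
def IsTrigPoly (f : ℂ → ℂ) : Prop :=
  ∃ (N : ℕ) (p : Fin N → ℂ) (θ : Fin N → ℝ),
    ∀ z : ℂ, f z = ∑ n, p n * Complex.exp (2 * (Real.pi : ℂ) * Complex.I * (θ n : ℂ) * z)

/-- Functions of bounded type on the upper half-plane. -/
def BoundedType (g : ℂ → ℂ) : Prop :=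
  ∃ P Q : ℂ → ℂ, DifferentiableOn ℂ P UHP ∧ DifferentiableOn ℂ Q UHP ∧
    (∃ C : ℝ, ∀ z ∈ UHP, ‖P z‖ ≤ C) ∧ (∃ C : ℝ, ∀ z ∈ UHP, ‖Q z‖ ≤ C) ∧
    (∀ z ∈ UHP, Q z ≠ 0) ∧ ∀ z ∈ UHP, g z = P z / Q z

/-- Mean type `ϑ(g) = limsup_{y→∞} log|g(iy)|/y`. -/
def MeanType (g : ℂ → ℂ) : ℝ :=
  Filter.limsup (fun y : ℝ => Real.log ‖g ((y : ℂ) * Complex.I)‖ / y) atTop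

/-- `E*(z) = conj (E (conj z))`. -/
def fstar (E : ℂ → ℂ) : ℂ → ℂ := fun z => (starRingEnd ℂ) (E ((starRingEnd ℂ) z))

/-- Hermite–Biehler class: entire with `|E*(z)| < |E(z)|` on the upper half-plane. -/
def HB (E : ℂ → ℂ) : Prop := Differentiable ℂ E ∧ ∀ z ∈ UHP, ‖fstar E z‖ < ‖E z‖

/-- `A = (E* + E)/2`. -/
def HBA (E : ℂ → ℂ) : ℂ → ℂ := fun z => (fstar E z + E z) / 2

/-- `B = (E* - E)/(2i)`. -/
def HBB (E : ℂ → ℂ) : ℂ → ℂ := fun z => (fstar E z - E z) / (2 * Complex.I)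

/-- `φ` is a phase function for `E`, with derivative `φd > 0`. -/
def IsPhaseFor (φ φd : ℝ → ℝ) (E : ℂ → ℂ) : Prop :=
  (∀ x : ℝ, HasDerivAt φ (φd x) x) ∧ (∀ x : ℝ, 0 < φd x) ∧
    ∀ x : ℝ, (Complex.exp (Complex.I * (φ x : ℂ)) * E (x : ℂ)).im = 0

/-- The points where `φ ≡ 0 (mod π)`. -/
def phaseZeros (φ : ℝ → ℝ) : Set ℝ := {γ : ℝ | ∃ k : ℤ, φ γ = k * Real.pi}

/-- The nonnegative measure `2π Σ_{φ(γ)≡0 (mod π)} (1/φ'(γ)) δ_γ`. -/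
def phaseMeasure (φ φd : ℝ → ℝ) : Measure ℝ :=
  Measure.sum fun γ : phaseZeros φ =>
    (ENNReal.ofReal (2 * Real.pi / φd (γ : ℝ))) • Measure.dirac (γ : ℝ)

/-- `μ` is an `ℕ`-valued nonnegative measure. -/
def CMeasure.NValued (μ : CMeasure) : Prop :=
  μ.Nonneg ∧ ∃ (Λ : Set ℝ) (m : ℝ → ℕ), LocFinSet Λ ∧ (∀ γ ∈ Λ, 0 < m γ) ∧
    μ.ν = Measure.sum fun γ : Λ => (m (γ : ℝ) : ℝ≥0∞) • Measure.dirac (γ : ℝ)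

/-- Bounded on every horizontal substrip of the upper half-plane. -/
def BddOnStrips (f : ℂ → ℂ) : Prop :=
  ∀ ε > (0:ℝ), ∃ C : ℝ, ∀ z : ℂ, ε < z.im → z.im < 1/ε → ‖f z‖ ≤ C

/-- The Fejér-type partial sums in formula (eq:fdef). -/
def fdefSum (a : ℝ → ℂ) (T : ℝ) (z : ℂ) : ℂ :=
  a 0 / 2 + ∑' lam : ℝ,
    Set.indicator (Set.Ioo (0 : ℝ) T)
      (fun l => a l * (1 - (l : ℂ) / (T : ℂ)) *
        Complex.exp (2 * (Real.pi : ℂ) * Complex.I * (l : ℂ) * z)) lam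

/-- The multiplicity of the zero `γ` of `Q` is `n`. -/
def ZeroMult (Q : ℂ → ℂ) (γ : ℝ) (n : ℕ) : Prop :=
  ∃ g : ℂ → ℂ, AnalyticAt ℂ g (γ : ℂ) ∧ g (γ : ℂ) ≠ 0 ∧
    ∀ᶠ z in 𝓝 (γ : ℂ), Q z = (z - (γ : ℂ)) ^ n * g z

/-- The Weierstrass elementary factor of genus one. -/
def elemFactor (w : ℂ) : ℂ := (1 - w) * Complex.exp w

lemma differentiable_elemFactor : Differentiable ℂ elemFactor := by
  unfold elemFactor; fun_prop

lemma norm_elemFactor_sub_one_le {w : ℂ} (hw : ‖w‖ ≤ 1) : ‖elemFactor w - 1‖ ≤ 3 * ‖w‖ ^ 2 := by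
  have h1 := Complex.norm_exp_sub_one_sub_id_le hw
  have h2 : elemFactor w - 1 = (1 - w) * (Complex.exp w - 1 - w) - w ^ 2 := by
    unfold elemFactor; ring
  have h3 : ‖1 - w‖ ≤ 2 := (norm_sub_le _ _).trans (by rw [norm_one]; linarith)
  calc ‖elemFactor w - 1‖ ≤ ‖1 - w‖ * ‖Complex.exp w - 1 - w‖ + ‖w‖ ^ 2 := by
        rw [h2]; exact (norm_sub_le _ _).trans (by rw [norm_mul, norm_pow])
    _ ≤ 2 * ‖w‖ ^ 2 + ‖w‖ ^ 2 := by gcongr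
    _ = _ := by ring

lemma norm_elemFactor_le (w : ℂ) : ‖elemFactor w‖ ≤ Real.exp (3 * ‖w‖ ^ 2) := by
  rcases le_total ‖w‖ 1 with hw | hw
  · have h1 := norm_elemFactor_sub_one_le hw
    have h2 : ‖elemFactor w‖ ≤ ‖elemFactor w - 1‖ + 1 := by
      simpa using norm_add_le (elemFactor w - 1) 1
    linarith [Real.add_one_le_exp (3 * ‖w‖ ^ 2)]
  · have h1 : ‖1 - w‖ ≤ Real.exp ‖w‖ :=
      (norm_sub_le _ _).trans (by rw [norm_one]; linarith [Real.add_one_le_exp ‖w‖])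
    have h2 : ‖Complex.exp w‖ ≤ Real.exp ‖w‖ := Complex.norm_exp_le_exp_norm w
    calc ‖elemFactor w‖ ≤ Real.exp ‖w‖ * Real.exp ‖w‖ := by
          unfold elemFactor; rw [norm_mul]; gcongr
      _ = Real.exp (2 * ‖w‖) := by rw [← Real.exp_add]; ring_nf
      _ ≤ _ := by apply Real.exp_le_exp.mpr; nlinarith

lemma elemFactor_eq_zero {w : ℂ} : elemFactor w = 0 ↔ w = 1 := by
  simp [elemFactor, sub_eq_zero, eq_comm (a := w)]

/-- The genus one canonical product with real zeros `g i`, centred at the real point `c`. -/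
def canonProd {ι : Type*} (g : ι → ℝ) (c : ℝ) (z : ℂ) : ℂ :=
  ∏' i, elemFactor ((z - c) / ((g i : ℂ) - c))

section CanonProd

variable {ι : Type*} {g : ι → ℝ} {c : ℝ}

lemma norm_canonArg (z : ℂ) (i : ι) :
    ‖(z - c) / ((g i : ℂ) - c)‖ ^ 2 = ‖z - c‖ ^ 2 * ((g i - c) ^ 2)⁻¹ := by
  rw [← Complex.ofReal_sub, norm_div, Complex.norm_real, div_pow, Real.norm_eq_abs, sq_abs,
    div_eq_mul_inv]

lemma eventually_norm_elemFactor_sub_one_le (hs : Summable fun i => ((g i - c) ^ 2)⁻¹) (R : ℝ) :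
    ∀ᶠ i in cofinite, ∀ z ∈ Metric.ball (c : ℂ) R,
      ‖elemFactor ((z - c) / ((g i : ℂ) - c)) - 1‖ ≤ 3 * R ^ 2 * ((g i - c) ^ 2)⁻¹ := by
  have h0 : Tendsto (fun i => R ^ 2 * ((g i - c) ^ 2)⁻¹) cofinite (𝓝 0) := by
    simpa using hs.tendsto_cofinite_zero.const_mul (R ^ 2)
  filter_upwards [h0.eventually (gt_mem_nhds one_pos)] with i hi z hz
  rw [Metric.mem_ball, dist_eq_norm] at hz
  have h1 : ‖(z - c) / ((g i : ℂ) - c)‖ ^ 2 ≤ R ^ 2 * ((g i - c) ^ 2)⁻¹ := by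
    rw [norm_canonArg]; gcongr
  have h2 : ‖(z - c) / ((g i : ℂ) - c)‖ ≤ 1 := by
    nlinarith [norm_nonneg ((z - c) / ((g i : ℂ) - c))]
  calc _ ≤ 3 * ‖(z - c) / ((g i : ℂ) - c)‖ ^ 2 := norm_elemFactor_sub_one_le h2
    _ ≤ 3 * (R ^ 2 * ((g i - c) ^ 2)⁻¹) := by gcongr
    _ = _ := by ring

lemma differentiable_canonFactor (i : ι) :
    Differentiable ℂ fun z : ℂ => elemFactor ((z - c) / ((g i : ℂ) - c)) :=
  differentiable_elemFactor.comp (by fun_prop)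

lemma canonProd_hasProdLocallyUniformlyOn (hs : Summable fun i => ((g i - c) ^ 2)⁻¹) (R : ℝ) :
    HasProdLocallyUniformlyOn (fun i (z : ℂ) => elemFactor ((z - c) / ((g i : ℂ) - c)))
      (canonProd g c) (Metric.ball (c : ℂ) R) := by
  have := Summable.hasProdLocallyUniformlyOn_one_add
    (f := fun i (z : ℂ) => elemFactor ((z - c) / ((g i : ℂ) - c)) - 1)
    Metric.isOpen_ball (hs.mul_left (3 * R ^ 2)) (eventually_norm_elemFactor_sub_one_le hs R)
    (fun i => ((differentiable_canonFactor i).sub_const 1).continuous.continuousOn)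
  simp only [add_sub_cancel] at this
  exact this

lemma mem_ball_canon (c : ℝ) (z : ℂ) : z ∈ Metric.ball (c : ℂ) (‖z - c‖ + 1) := by
  rw [Metric.mem_ball, dist_eq_norm]; linarith

lemma canonProd_hasProd (hs : Summable fun i => ((g i - c) ^ 2)⁻¹) (z : ℂ) :
    HasProd (fun i => elemFactor ((z - c) / ((g i : ℂ) - c))) (canonProd g c z) :=
  (canonProd_hasProdLocallyUniformlyOn hs (‖z - c‖ + 1)).hasProd (mem_ball_canon c z)

lemma differentiable_canonProd (hs : Summable fun i => ((g i - c) ^ 2)⁻¹) :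
    Differentiable ℂ (canonProd g c) := by
  intro z
  have h := canonProd_hasProdLocallyUniformlyOn hs (‖z - c‖ + 1)
  have h2 : DifferentiableOn ℂ (canonProd g c) (Metric.ball (c : ℂ) (‖z - c‖ + 1)) := by
    refine (hasProdLocallyUniformlyOn_iff_tendstoLocallyUniformlyOn.1 h).differentiableOn
      (Eventually.of_forall fun s => ?_) Metric.isOpen_ball
    exact (Differentiable.fun_finsetProd fun i _ => differentiable_canonFactor i).differentiableOn
  exact h2.differentiableAt (Metric.isOpen_ball.mem_nhds (mem_ball_canon c z))

lemma norm_canonProd_le (hs : Summable fun i => ((g i - c) ^ 2)⁻¹) (z : ℂ) :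
    ‖canonProd g c z‖ ≤ Real.exp (3 * (∑' i, ((g i - c) ^ 2)⁻¹) * ‖z - c‖ ^ 2) := by
  refine le_of_tendsto (canonProd_hasProd hs z).norm (Eventually.of_forall fun s => ?_)
  calc _ ≤ ∏ i ∈ s, Real.exp (3 * (‖z - c‖ ^ 2 * ((g i - c) ^ 2)⁻¹)) := by
        refine Finset.prod_le_prod (fun _ _ => norm_nonneg _) fun i _ => ?_
        rw [← norm_canonArg]; exact norm_elemFactor_le _
    _ = Real.exp (3 * ‖z - c‖ ^ 2 * ∑ i ∈ s, ((g i - c) ^ 2)⁻¹) := by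
        rw [← Real.exp_sum, Finset.mul_sum]; congr 1; refine Finset.sum_congr rfl fun i _ => by ring
    _ ≤ _ := by
        apply Real.exp_le_exp.mpr
        have := hs.sum_le_tsum s (fun i _ => by positivity)
        nlinarith [sq_nonneg ‖z - c‖]

lemma canonFactor_eq_zero (hg : ∀ i, g i ≠ c) (z : ℂ) (i : ι) :
    elemFactor ((z - c) / ((g i : ℂ) - c)) = 0 ↔ z = g i := by
  have : (g i : ℂ) - c ≠ 0 := by
    rw [sub_ne_zero]; exact_mod_cast hg i
  rw [elemFactor_eq_zero, div_eq_one_iff_eq this, sub_left_inj]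

lemma canonProd_eq_zero (hg : ∀ i, g i ≠ c) (hs : Summable fun i => ((g i - c) ^ 2)⁻¹) (z : ℂ) :
    canonProd g c z = 0 ↔ ∃ i, z = g i := by
  constructor
  · intro h
    by_contra! hne
    have h1 : Summable fun i => ‖elemFactor ((z - c) / ((g i : ℂ) - c)) - 1‖ := by
      refine Summable.of_norm_bounded_eventually
        (hs.mul_left (3 * (‖z - c‖ + 1) ^ 2)) ?_
      filter_upwards [eventually_norm_elemFactor_sub_one_le hs (‖z - c‖ + 1)] with i hi
      rw [norm_norm]
      exact hi z (mem_ball_canon c z)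
    refine tprod_one_add_ne_zero_of_summable
      (f := fun i => elemFactor ((z - c) / ((g i : ℂ) - c)) - 1) (fun i => ?_) h1 ?_
    · rw [add_sub_cancel, Ne, canonFactor_eq_zero hg]; exact hne i
    · simpa [canonProd] using h
  · rintro ⟨i, hi⟩
    exact tprod_of_exists_eq_zero ⟨i, (canonFactor_eq_zero hg z i).2 hi⟩

lemma canonProd_conj (hs : Summable fun i => ((g i - c) ^ 2)⁻¹) (z : ℂ) :
    canonProd g c ((starRingEnd ℂ) z) = (starRingEnd ℂ) (canonProd g c z) := by
  have h := (canonProd_hasProd hs z).map (starRingEnd ℂ) Complex.continuous_conj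
  refine (h.congr_fun ?_).tprod_eq
  intro i
  simp [elemFactor, ← Complex.exp_conj]

lemma logDeriv_canonFactor (hg : ∀ i, g i ≠ c) {z : ℂ} {i : ι} (hz : z ≠ g i) :
    logDeriv (fun z : ℂ => elemFactor ((z - c) / ((g i : ℂ) - c))) z
      = 1 / (z - g i) + 1 / ((g i : ℂ) - c) := by
  have h0 : (g i : ℂ) - c ≠ 0 := by
    rw [sub_ne_zero]; exact_mod_cast hg i
  have hz' : z - g i ≠ 0 := sub_ne_zero.2 hz
  have h1 : HasDerivAt (fun z : ℂ => (z - c) / ((g i : ℂ) - c)) (1 / ((g i : ℂ) - c)) z :=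
    ((hasDerivAt_id z).sub_const _).div_const _
  have h2 := (h1.const_sub 1).mul h1.cexp
  have h3 : 1 - (z - c) / ((g i : ℂ) - c) = - (z - g i) / ((g i : ℂ) - c) := by field_simp; ring
  rw [logDeriv_apply]
  unfold elemFactor
  erw [h2.deriv]
  rw [h3]
  field_simp
  ring

lemma summable_canon_logDeriv (hg : ∀ i, g i ≠ c) (hs : Summable fun i => ((g i - c) ^ 2)⁻¹)
    {z : ℂ} (hz : ∀ i, z ≠ g i) :
    Summable fun i => 1 / (z - g i) + 1 / ((g i : ℂ) - c) := by
  have h0 : Tendsto (fun i => 4 * ‖z - c‖ ^ 2 * ((g i - c) ^ 2)⁻¹) cofinite (𝓝 0) := by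
    simpa using hs.tendsto_cofinite_zero.const_mul (4 * ‖z - c‖ ^ 2)
  refine Summable.of_norm_bounded_eventually (hs.mul_left (2 * ‖z - c‖)) ?_
  filter_upwards [h0.eventually (gt_mem_nhds one_pos)] with i hi
  have hgi : 0 < |g i - c| := abs_pos.2 (sub_ne_zero.2 (hg i))
  have h0 : (g i : ℂ) - c ≠ 0 := by
    rw [sub_ne_zero]; exact_mod_cast hg i
  have hz' : z - g i ≠ 0 := sub_ne_zero.2 (hz i)
  have h1 : 1 / (z - g i) + 1 / ((g i : ℂ) - c) = (z - c) / ((z - g i) * ((g i : ℂ) - c)) := by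
    field_simp; ring
  have hn : ‖(g i : ℂ) - c‖ = |g i - c| := by
    rw [← Complex.ofReal_sub, Complex.norm_real, Real.norm_eq_abs]
  have h2 : 2 * ‖z - c‖ ≤ |g i - c| := by
    rw [← sq_abs (g i - c), mul_inv_lt_iff₀ (by positivity)] at hi
    nlinarith [norm_nonneg (z - c)]
  have h3 : |g i - c| / 2 ≤ ‖z - g i‖ := by
    have : ‖(g i : ℂ) - c‖ ≤ ‖z - c‖ + ‖z - g i‖ := by
      have := norm_sub_le (z - c) (z - g i)
      simpa using this
    rw [hn] at this; linarith
  rw [h1, norm_div, norm_mul, hn, ← sq_abs (g i - c)]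
  calc ‖z - c‖ / (‖z - g i‖ * |g i - c|) ≤ ‖z - c‖ / (|g i - c| / 2 * |g i - c|) := by gcongr
    _ = _ := by field_simp

lemma logDeriv_canonProd (hg : ∀ i, g i ≠ c) (hs : Summable fun i => ((g i - c) ^ 2)⁻¹)
    {z : ℂ} (hz : ∀ i, z ≠ g i) :
    logDeriv (canonProd g c) z = ∑' i, (1 / (z - g i) + 1 / ((g i : ℂ) - c)) := by
  have h := canonProd_hasProdLocallyUniformlyOn hs (‖z - c‖ + 1)
  have := logDeriv_tprod_eq_tsum Metric.isOpen_ball (mem_ball_canon c z)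
    (f := fun i (z : ℂ) => elemFactor ((z - c) / ((g i : ℂ) - c)))
    (fun i => by rw [Ne, canonFactor_eq_zero hg]; exact hz i)
    (fun i => (differentiable_canonFactor i).differentiableOn)
    (by simp_rw [logDeriv_canonFactor hg (hz _)]; exact summable_canon_logDeriv hg hs hz)
    h.multipliableLocallyUniformlyOn
    (by
      have := (canonProd_eq_zero hg hs z).not.2 (by simpa using hz)
      exact this)
  simp_rw [logDeriv_canonFactor hg (hz _)] at this
  exact this

lemma zeroMult_canonProd (hg : ∀ i, g i ≠ c) (hs : Summable fun i => ((g i - c) ^ 2)⁻¹) (x : ℝ) :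
    ZeroMult (canonProd g c) x (Nat.card {i // g i = x}) := by
  classical
  set s : Set ι := {i | g i = x} with hsdef
  have hfin : s.Finite := by
    by_cases hx : x = c
    · have : s = ∅ := by
        ext i; simp [hsdef, hx, hg i]
      rw [this]; exact finite_empty
    · have h0 := hs.tendsto_cofinite_zero.eventually
        (gt_mem_nhds (show 0 < ((x - c) ^ 2)⁻¹ from inv_pos.2 (by
          have := sub_ne_zero.2 hx
          positivity)))
      rw [eventually_cofinite] at h0
      refine h0.subset fun i hi => ?_
      have : g i = x := hi
      simp [this]
  have : Finite s := hfin
  have := Fintype.ofFinite s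
  have hs' : Summable fun i : (sᶜ : Set ι) => ((g i - c) ^ 2)⁻¹ := hs.subtype sᶜ
  have hsplit : ∀ z, canonProd g c z
      = (elemFactor ((z - c) / ((x : ℂ) - c))) ^ (Nat.card s)
        * canonProd (fun i : (sᶜ : Set ι) => g i) c z := by
    intro z
    have h1 : HasProd ((fun i => elemFactor ((z - c) / ((g i : ℂ) - c))) ∘ ((↑) : s → ι))
        ((elemFactor ((z - c) / ((x : ℂ) - c))) ^ (Nat.card s)) := by
      have h2 := hasProd_fintype ((fun i => elemFactor ((z - c) / ((g i : ℂ) - c))) ∘ ((↑) : s → ι))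
      convert h2 using 1
      rw [Nat.card_eq_fintype_card, ← Finset.card_univ, ← Finset.prod_const]
      refine Finset.prod_congr rfl fun i _ => ?_
      have : g i = x := i.2
      simp [this]
    have h3 := h1.mul_compl (canonProd_hasProd (g := fun i : (sᶜ : Set ι) => g i) hs' z)
    exact h3.tprod_eq
  change ZeroMult _ _ (Nat.card s)
  rcases isEmpty_or_nonempty s with he | ⟨⟨i₀, hi₀⟩⟩
  · refine ⟨canonProd g c, (differentiable_canonProd hs).analyticAt _, ?_, ?_⟩
    · rw [Ne, canonProd_eq_zero hg hs]
      rintro ⟨i, hi⟩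
      exact he.elim ⟨i, by
        have : x = g i := by exact_mod_cast hi
        exact this.symm⟩
    · simp
  · have hxc : (x : ℂ) - c ≠ 0 := by
      have : g i₀ = x := hi₀
      rw [sub_ne_zero, ← this]; exact_mod_cast hg i₀
    refine ⟨fun z => (-1 / ((x : ℂ) - c) * Complex.exp ((z - c) / ((x : ℂ) - c))) ^ (Nat.card s)
        * canonProd (fun i : (sᶜ : Set ι) => g i) c z, ?_, ?_, ?_⟩
    · refine Differentiable.analyticAt ?_ _
      have := differentiable_canonProd hs'
      fun_prop
    · refine mul_ne_zero (pow_ne_zero _ (mul_ne_zero ?_ (Complex.exp_ne_zero _))) ?_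
      · exact div_ne_zero (by norm_num) hxc
      · rw [Ne, canonProd_eq_zero (g := fun i : (sᶜ : Set ι) => g i) (fun i => hg i) hs']
        rintro ⟨i, hi⟩
        refine i.2 ?_
        have : x = g i := by exact_mod_cast hi
        exact this.symm
    · refine Eventually.of_forall fun z => ?_
      rw [hsplit z, ← mul_assoc, ← mul_pow]
      congr 2
      unfold elemFactor
      field_simp
      ring

end CanonProd

/-- The summation formula `∑ φ̂(g i) = ∑ a(λ) φ(λ)` on smooth compactly supported functions. -/
def PoissonSum {ι : Type*} (g : ι → ℝ) (a : ℝ → ℂ) : Prop :=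
  ∀ φ : ℝ → ℂ, ContDiff ℝ (⊤ : ℕ∞) φ → HasCompactSupport φ →
    HasSum (fun i => FT φ (g i)) (∑' lam : ℝ, a lam * φ lam)

lemma FT_eq_fourier (φ : ℝ → ℂ) (ξ : ℝ) : FT φ ξ = FourierTransform.fourier φ ξ := by
  rw [Real.fourier_real_eq_integral_exp_smul, FT]
  refine integral_congr_ae (Eventually.of_forall fun x => ?_)
  simp only [smul_eq_mul]
  rw [mul_comm]
  congr 2
  push_cast
  ring

lemma LocFinSet.exists_gap {S : Set ℝ} (hS : LocFinSet S) :
    ∃ δ > (0 : ℝ), ∀ x ∈ S, x ≠ 0 → δ ≤ |x| := by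
  have hfin : ((S ∩ Ioo (-1) 1) \ {0}).Finite := (hS (-1) 1).subset sdiff_subset
  have hnhds : ((S ∩ Ioo (-1) 1) \ {0})ᶜ ∈ 𝓝 (0 : ℝ) :=
    hfin.isClosed.isOpen_compl.mem_nhds (by simp)
  obtain ⟨ε, hε, hball⟩ := Metric.mem_nhds_iff.1 hnhds
  refine ⟨min ε 1, by positivity, fun x hx hx0 => ?_⟩
  by_contra! hlt
  have h1 : x ∈ Metric.ball (0 : ℝ) ε := by
    rw [Metric.mem_ball, dist_zero_right, Real.norm_eq_abs]; exact hlt.trans_le (min_le_left _ _)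
  refine hball h1 ⟨⟨hx, ?_⟩, hx0⟩
  exact abs_lt.1 (hlt.trans_le (min_le_right _ _))

/-- Modulation of the test function translates its Fourier transform. -/
lemma FT_modulate (φ : ℝ → ℂ) (t ξ : ℝ) :
    FT (fun x => φ x * Complex.exp (2 * (Real.pi : ℂ) * Complex.I * (x : ℂ) * (t : ℂ))) ξ
      = FT φ (ξ - t) := by
  unfold FT
  refine integral_congr_ae (Eventually.of_forall fun x => ?_)
  simp only
  rw [mul_assoc, ← Complex.exp_add]
  congr 2
  push_cast
  ring

lemma FT_even_real {ψ : ℝ → ℝ} (hψ : ∀ x, ψ (-x) = ψ x) (ξ : ℝ) :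
    FT (fun x => (ψ x : ℂ)) ξ = ((FT (fun x => (ψ x : ℂ)) ξ).re : ℂ) := by
  refine Eq.symm (Complex.conj_eq_iff_re.1 ?_)
  unfold FT
  rw [← integral_conj, ← integral_neg_eq_self]
  refine integral_congr_ae (Eventually.of_forall fun x => ?_)
  simp only [map_mul, Complex.conj_ofReal, ← Complex.exp_conj, hψ, map_neg, Complex.conj_I,
    map_ofNat]
  congr 2
  push_cast
  ring

/-- A smooth test function supported near the origin whose Fourier transform is nonnegative
everywhere and positive near the origin. -/
lemma exists_test_function {δ : ℝ} (hδ : 0 < δ) :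
    ∃ (φ : ℝ → ℂ) (G : ℝ → ℝ), ContDiff ℝ (⊤ : ℕ∞) φ ∧ HasCompactSupport φ ∧
      (∀ x, φ x ≠ 0 → |x| < δ) ∧ (∀ ξ, FT φ ξ = G ξ) ∧ (∀ ξ, 0 ≤ G ξ) ∧ Continuous G ∧
      0 < G 0 := by
  let b : ContDiffBump (0 : ℝ) := ⟨δ / 4, δ / 2, by positivity, by linarith⟩
  let ψ : ℝ → ℂ := fun x => (b x : ℂ)
  have hψc : ContDiff ℝ (⊤ : ℕ∞) ψ := Complex.ofRealCLM.contDiff.comp b.contDiff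
  have hψs : HasCompactSupport ψ := b.hasCompactSupport.comp_left (g := ((↑) : ℝ → ℂ)) rfl
  have hψi : Integrable ψ := hψc.continuous.integrable_of_hasCompactSupport hψs
  have hreal := FT_even_real (ψ := b) b.neg
  refine ⟨convolution ψ ψ (ContinuousLinearMap.mul ℂ ℂ) volume, fun ξ => (FT ψ ξ).re ^ 2,
    ?_, hψs.convolution _ hψs, ?_, ?_, fun _ => sq_nonneg _, ?_, ?_⟩
  · have := hψs.contDiff_convolution_right (n := ⊤) (μ := volume)
      (ContinuousLinearMap.mul ℝ ℂ) hψi.locallyIntegrable hψc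
    exact this
  · intro x hx
    obtain ⟨y, hy, z, hz, rfl⟩ := support_convolution_subset _ hx
    have hsupp : ∀ y, y ∈ Function.support ψ → |y| < δ / 2 := by
      intro y hy
      have h : y ∈ Function.support b := fun h => hy (by simp [ψ, h])
      rw [b.support_eq] at h
      simpa using h
    have := abs_add_le y z
    have := hsupp y hy
    have := hsupp z hz
    linarith
  · intro ξ
    rw [FT_eq_fourier, Real.fourier_mul_convolution_eq hψi hψi, ← FT_eq_fourier, hreal ξ]
    push_cast
    rw [sq]
  · have : Continuous (FT ψ) := by
      have h : FT ψ = FourierTransform.fourier ψ := funext (FT_eq_fourier ψ)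
      rw [h]
      exact VectorFourier.fourierIntegral_continuous Real.continuous_fourierChar
        (by fun_prop) hψi
    fun_prop
  · have h0 : FT ψ 0 = ((∫ x, b x : ℝ) : ℂ) := by
      unfold FT
      simp only [ψ, Complex.ofReal_zero, mul_zero, neg_zero, Complex.exp_zero, mul_one]
      exact integral_ofReal
    have hpos : 0 < ∫ x, b x := b.integral_pos
    simp only [h0, Complex.ofReal_re]
    positivity

/-- The points of a summation formula with discrete spectrum near the origin are sparse. -/
lemma PoissonSum.summable_inv_one_add_sq {ι : Type*} [Countable ι] {g : ι → ℝ} {a : ℝ → ℂ}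
    (h : PoissonSum g a) (ha : LocFinSet (Function.support a)) :
    Summable fun i => (1 + g i ^ 2)⁻¹ := by
  obtain ⟨δ, hδ, hgap⟩ := ha.exists_gap
  obtain ⟨φ, G, hφ, hφs, hφδ, hFT, hG0, hGc, hGpos⟩ := exists_test_function hδ
  have hsum : ∀ t : ℝ, HasSum (fun i => G (g i - t)) (a 0 * φ 0).re := by
    intro t
    have h1 := h (fun x => φ x * Complex.exp (2 * (Real.pi : ℂ) * Complex.I * (x : ℂ) * (t : ℂ)))
      (hφ.mul (by
        refine ContDiff.cexp ?_
        have : ContDiff ℝ (⊤ : ℕ∞) (fun x : ℝ => (x : ℂ)) := Complex.ofRealCLM.contDiff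
        fun_prop)) (hφs.mul_right)
    rw [tsum_eq_single 0] at h1
    · simp only [FT_modulate, hFT] at h1
      have := Complex.hasSum_re h1
      simpa using this
    · intro lam hlam
      by_cases h0 : a lam = 0
      · simp [h0]
      · have : φ lam = 0 := by
          by_contra hne
          exact absurd (hφδ lam hne) (not_lt.2 (hgap lam h0 hlam))
        simp [this]
  obtain ⟨η, hη, hη1, c₀, hc₀, hGη⟩ : ∃ η > (0 : ℝ), η ≤ 1 ∧ ∃ c₀ > (0 : ℝ), ∀ x, |x| ≤ η → c₀ ≤ G x := by
    have := hGc.continuousAt.eventually (lt_mem_nhds (show G 0 / 2 < G 0 by linarith))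
    obtain ⟨ε, hε, hball⟩ := Metric.eventually_nhds_iff.1 this
    refine ⟨min (ε / 2) 1, by positivity, min_le_right _ _, G 0 / 2, by positivity, fun x hx => ?_⟩
    refine (hball ?_).le
    rw [dist_zero_right, Real.norm_eq_abs]
    have := min_le_left (ε / 2) 1
    linarith
  have hmeas : ∀ i, Measurable fun t : ℝ => ENNReal.ofReal (G (g i - t) * (1 + t ^ 2)⁻¹) := by
    intro i
    refine (Measurable.mul ?_ ?_).ennreal_ofReal
    · exact (hGc.comp (by fun_prop)).measurable
    · fun_prop
  have hfin : ∑' i, ∫⁻ t : ℝ, ENNReal.ofReal (G (g i - t) * (1 + t ^ 2)⁻¹) ≠ ⊤ := by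
    rw [← lintegral_tsum fun i => (hmeas i).aemeasurable]
    have h1 : ∀ t : ℝ, ∑' i, ENNReal.ofReal (G (g i - t) * (1 + t ^ 2)⁻¹)
        = ENNReal.ofReal ((a 0 * φ 0).re * (1 + t ^ 2)⁻¹) := by
      intro t
      have h2 := (hsum t).mul_right ((1 + t ^ 2)⁻¹)
      rw [← h2.tsum_eq, ENNReal.ofReal_tsum_of_nonneg (fun i => ?_) h2.summable]
      have := hG0 (g i - t)
      positivity
    simp_rw [h1]
    exact (integrable_inv_one_add_sq.const_mul _).lintegral_lt_top.ne
  have hlow : ∀ i, ENNReal.ofReal (2 * η * c₀ / 3 * (1 + g i ^ 2)⁻¹)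
      ≤ ∫⁻ t : ℝ, ENNReal.ofReal (G (g i - t) * (1 + t ^ 2)⁻¹) := by
    intro i
    calc _ = ∫⁻ _ in Icc (g i - η) (g i + η), ENNReal.ofReal (c₀ / 3 * (1 + g i ^ 2)⁻¹) := by
          rw [setLIntegral_const, Real.volume_Icc, ← ENNReal.ofReal_mul (by positivity)]
          congr 1
          ring
      _ ≤ ∫⁻ t in Icc (g i - η) (g i + η), ENNReal.ofReal (G (g i - t) * (1 + t ^ 2)⁻¹) := by
          refine setLIntegral_mono (hmeas i) fun t ht => ENNReal.ofReal_le_ofReal ?_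
          have h1 : |g i - t| ≤ η := abs_le.2 ⟨by linarith [ht.2], by linarith [ht.1]⟩
          have h2 : 1 + t ^ 2 ≤ 3 * (1 + g i ^ 2) := by
            have h3 : |g i - t| ≤ 1 := h1.trans hη1
            have h4 : (g i - t) ^ 2 ≤ 1 := by rw [← sq_abs]; nlinarith [abs_nonneg (g i - t)]
            nlinarith [sq_nonneg (2 * g i - t)]
          calc c₀ / 3 * (1 + g i ^ 2)⁻¹ = c₀ * (3 * (1 + g i ^ 2))⁻¹ := by
                rw [mul_inv]; ring
            _ ≤ G (g i - t) * (1 + t ^ 2)⁻¹ := by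
                have := hGη _ h1
                have := hG0 (g i - t)
                gcongr
      _ ≤ _ := setLIntegral_le_lintegral _ _
  have h2 : ∑' i, ENNReal.ofReal (2 * η * c₀ / 3 * (1 + g i ^ 2)⁻¹) ≠ ⊤ :=
    ne_top_of_le_ne_top hfin (ENNReal.tsum_le_tsum hlow)
  have h3 := ENNReal.summable_toReal h2
  have h4 : Summable fun i => 2 * η * c₀ / 3 * (1 + g i ^ 2)⁻¹ := by
    refine h3.congr fun i => ?_
    rw [ENNReal.toReal_ofReal (by positivity)]
  exact (summable_mul_left_iff (by positivity)).1 h4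

lemma summable_inv_sub_sq {ι : Type*} {g : ι → ℝ} (h : Summable fun i => (1 + g i ^ 2)⁻¹) (c : ℝ) :
    Summable fun i => ((g i - c) ^ 2)⁻¹ := by
  have h0 := h.tendsto_cofinite_zero.eventually
    (gt_mem_nhds (show 0 < (2 + 4 * c ^ 2)⁻¹ by positivity))
  refine Summable.of_norm_bounded_eventually (h.mul_left 4) ?_
  filter_upwards [h0] with i hi
  rw [inv_lt_inv₀ (by positivity) (by positivity)] at hi
  rw [Real.norm_of_nonneg (by positivity)]
  have h1 : 1 + g i ^ 2 ≤ 4 * (g i - c) ^ 2 := by nlinarith [sq_nonneg (g i - 2 * c)]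
  have h2 : 0 < (g i - c) ^ 2 := by nlinarith [sq_nonneg (g i)]
  rw [inv_le_comm₀ h2 (by positivity), mul_inv, inv_inv]
  linarith

lemma norm_FT_le (φ : ℝ → ℂ) (ξ : ℝ) : ‖FT φ ξ‖ ≤ ∫ x, ‖φ x‖ := by
  refine (norm_integral_le_integral_norm _).trans_eq ?_
  refine integral_congr_ae (Eventually.of_forall fun x => ?_)
  simp only [norm_mul]
  rw [Complex.norm_exp]
  simp

/-- Quadratic decay of the Fourier transform of a twice differentiable function. -/
lemma norm_FT_le_of_deriv_two {φ φ' φ'' : ℝ → ℂ} (h1 : ∀ x, HasDerivAt φ (φ' x) x)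
    (h2 : ∀ x, HasDerivAt φ' (φ'' x) x) (hi : Integrable φ) (hi1 : Integrable φ')
    (hi2 : Integrable φ'') {A B : ℝ} (hA : ∫ x, ‖φ x‖ ≤ A) (hB : ∫ x, ‖φ'' x‖ ≤ B) (ξ : ℝ) :
    ‖FT φ ξ‖ ≤ (A + B) * (1 + ξ ^ 2)⁻¹ := by
  have e1 : deriv φ = φ' := funext fun x => (h1 x).deriv
  have e2 : deriv φ' = φ'' := funext fun x => (h2 x).deriv
  have f1 := congrFun (Real.fourier_deriv hi (fun x => (h1 x).differentiableAt) (e1 ▸ hi1)) ξ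
  have f2 := congrFun (Real.fourier_deriv hi1 (fun x => (h2 x).differentiableAt) (e2 ▸ hi2)) ξ
  rw [e1] at f1
  rw [e2] at f2
  simp only [← FT_eq_fourier, smul_eq_mul] at f1 f2
  have h3 : ‖FT φ'' ξ‖ = 4 * Real.pi ^ 2 * ξ ^ 2 * ‖FT φ ξ‖ := by
    rw [f2, f1]
    simp only [norm_mul, Complex.norm_real, Complex.norm_I, Real.norm_eq_abs, Complex.norm_ofNat,
      abs_of_pos Real.pi_pos]
    rw [← sq_abs ξ]
    ring
  have h4 := (norm_FT_le φ'' ξ).trans hB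
  have h5 := (norm_FT_le φ ξ).trans hA
  rw [h3] at h4
  rw [← div_eq_mul_inv, le_div_iff₀ (by positivity)]
  have : 1 ≤ 4 * Real.pi ^ 2 := by nlinarith [Real.pi_gt_three]
  nlinarith [mul_nonneg (norm_nonneg (FT φ ξ)) (sq_nonneg ξ)]

lemma exists_smoothTransition_derivs :
    ∃ (S₁ S₂ : ℝ → ℝ) (M : ℝ), 1 ≤ M ∧ (∀ x, HasDerivAt Real.smoothTransition (S₁ x) x) ∧
      (∀ x, HasDerivAt S₁ (S₂ x) x) ∧ Continuous S₂ ∧ (∀ x, |S₁ x| ≤ M) ∧ (∀ x, |S₂ x| ≤ M) ∧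
      (∀ x, x < 0 → S₁ x = 0 ∧ S₂ x = 0) ∧ (∀ x, 1 < x → S₁ x = 0 ∧ S₂ x = 0) := by
  have hS : ContDiff ℝ (⊤ : ℕ∞) Real.smoothTransition := Real.smoothTransition.contDiff
  have hS1 : ContDiff ℝ (⊤ : ℕ∞) (deriv Real.smoothTransition) :=
    hS.iterate_deriv 1
  have hS2 : ContDiff ℝ (⊤ : ℕ∞) (deriv (deriv Real.smoothTransition)) :=
    hS.iterate_deriv 2
  have hz1 : ∀ x < 0, deriv Real.smoothTransition x = 0 := fun x hx => by
    have : Real.smoothTransition =ᶠ[𝓝 x] fun _ => 0 := by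
      filter_upwards [gt_mem_nhds hx] with y hy using Real.smoothTransition.zero_of_nonpos hy.le
    rw [this.deriv_eq, deriv_const]
  have hz2 : ∀ x < 0, deriv (deriv Real.smoothTransition) x = 0 := fun x hx => by
    have : deriv Real.smoothTransition =ᶠ[𝓝 x] fun _ => 0 := by
      filter_upwards [gt_mem_nhds hx] with y hy using hz1 y hy
    rw [this.deriv_eq, deriv_const]
  have ho1 : ∀ x > 1, deriv Real.smoothTransition x = 0 := fun x hx => by
    have : Real.smoothTransition =ᶠ[𝓝 x] fun _ => 1 := by
      filter_upwards [lt_mem_nhds hx] with y hy using Real.smoothTransition.one_of_one_le hy.le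
    rw [this.deriv_eq, deriv_const]
  have ho2 : ∀ x > 1, deriv (deriv Real.smoothTransition) x = 0 := fun x hx => by
    have : deriv Real.smoothTransition =ᶠ[𝓝 x] fun _ => 0 := by
      filter_upwards [lt_mem_nhds hx] with y hy using ho1 y hy
    rw [this.deriv_eq, deriv_const]
  have hsupp : ∀ f : ℝ → ℝ, (∀ x < 0, f x = 0) → (∀ x > 1, f x = 0) → HasCompactSupport f := by
    intro f h0 h1
    refine HasCompactSupport.intro (isCompact_Icc (a := (0 : ℝ)) (b := 1)) fun x hx => ?_
    rcases lt_or_ge x 0 with h | h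
    · exact h0 x h
    · exact h1 x (by by_contra! h'; exact hx ⟨h, h'⟩)
  obtain ⟨M₁, hM₁⟩ := hS1.continuous.bounded_above_of_compact_support (hsupp _ hz1 ho1)
  obtain ⟨M₂, hM₂⟩ := hS2.continuous.bounded_above_of_compact_support (hsupp _ hz2 ho2)
  refine ⟨deriv Real.smoothTransition, deriv (deriv Real.smoothTransition), max 1 (max M₁ M₂),
    le_max_left _ _, fun x => ?_, fun x => ?_, hS2.continuous, fun x => ?_, fun x => ?_,
    fun x hx => ⟨hz1 x hx, hz2 x hx⟩, fun x hx => ⟨ho1 x hx, ho2 x hx⟩⟩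
  · exact (hS.differentiable (by simp) x).hasDerivAt
  · exact (hS1.differentiable (by simp) x).hasDerivAt
  · exact (hM₁ x).trans ((le_max_left _ _).trans (le_max_right _ _))
  · exact (hM₂ x).trans ((le_max_right _ _).trans (le_max_right _ _))

/-- The smooth cutoff, increasing on `[0, 1 / n]` and decreasing on `[n - 1, n]`. -/
def plateau (n : ℕ) (x : ℝ) : ℝ :=
  Real.smoothTransition (n * x) * Real.smoothTransition (n - x)

lemma plateau_of_nonpos (n : ℕ) {x : ℝ} (hx : x ≤ 0) : plateau n x = 0 := by
  rw [plateau, Real.smoothTransition.zero_of_nonpos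
    (mul_nonpos_of_nonneg_of_nonpos n.cast_nonneg hx), zero_mul]

lemma abs_plateau_le (n : ℕ) (x : ℝ) : |plateau n x| ≤ 1 := by
  rw [plateau, abs_mul, abs_of_nonneg (Real.smoothTransition.nonneg _),
    abs_of_nonneg (Real.smoothTransition.nonneg _)]
  exact mul_le_one₀ (Real.smoothTransition.le_one _) (Real.smoothTransition.nonneg _)
    (Real.smoothTransition.le_one _)

lemma contDiff_plateau (n : ℕ) : ContDiff ℝ (⊤ : ℕ∞) (plateau n) := by
  have hS : ContDiff ℝ (⊤ : ℕ∞) Real.smoothTransition := Real.smoothTransition.contDiff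
  exact (hS.comp (by fun_prop)).mul (hS.comp (by fun_prop))

lemma hasCompactSupport_plateau (n : ℕ) : HasCompactSupport (plateau n) := by
  refine HasCompactSupport.intro (isCompact_Icc (a := (0 : ℝ)) (b := n)) fun x hx => ?_
  rcases le_or_gt x 0 with h | h
  · exact plateau_of_nonpos n h
  · have : (n : ℝ) - x ≤ 0 := by
      by_contra! h'
      exact hx ⟨h.le, by linarith⟩
    rw [plateau, Real.smoothTransition.zero_of_nonpos this, mul_zero]

lemma eventually_plateau_eq_one {x : ℝ} (hx : 0 < x) : ∀ᶠ n : ℕ in atTop, plateau n x = 1 := by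
  have h1 := tendsto_natCast_atTop_atTop (R := ℝ) |>.eventually_ge_atTop (1 / x)
  have h2 := tendsto_natCast_atTop_atTop (R := ℝ) |>.eventually_ge_atTop (x + 1)
  filter_upwards [h1, h2] with n h1 h2
  rw [plateau, Real.smoothTransition.one_of_one_le, Real.smoothTransition.one_of_one_le, mul_one]
  · linarith
  · rwa [div_le_iff₀ hx] at h1

/-- The truncated test functions have uniformly bounded second derivative in `L¹`. -/
lemma exists_FT_plateau_bound {h h' h'' : ℝ → ℂ} (hd1 : ∀ x, HasDerivAt h (h' x) x)
    (hd2 : ∀ x, HasDerivAt h' (h'' x) x) (hc : Continuous h'') {B d : ℝ} (hd : 0 < d)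
    (hB : ∀ x, 0 ≤ x → ‖h x‖ ≤ B * Real.exp (-d * x))
    (hB1 : ∀ x, 0 ≤ x → ‖h' x‖ ≤ B * Real.exp (-d * x))
    (hB2 : ∀ x, 0 ≤ x → ‖h'' x‖ ≤ B * Real.exp (-d * x))
    (hB0 : ∀ x, 0 ≤ x → ‖h x‖ ≤ B * x) :
    ∃ C, ∀ n : ℕ, 0 < n → ∀ ξ, ‖FT (fun x => h x * plateau n x) ξ‖ ≤ C * (1 + ξ ^ 2)⁻¹ := by
  obtain ⟨S₁, S₂, M, hM, hS1, hS2, hS2c, hb1, hb2, hneg, hgt⟩ := exists_smoothTransition_derivs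
  set S := Real.smoothTransition
  have hSb : ∀ x, |S x| ≤ 1 := fun x => by
    rw [abs_of_nonneg (Real.smoothTransition.nonneg _)]; exact Real.smoothTransition.le_one _
  have hB0' : 0 ≤ B := by simpa using (norm_nonneg _).trans (hB 0 le_rfl)
  have hM0 : 0 ≤ M := by linarith
  have hSc : Continuous S := Real.smoothTransition.continuous
  have hS1c : Continuous S₁ := continuous_iff_continuousAt.2 fun x => (hS2 x).continuousAt
  have hhc : Continuous h := continuous_iff_continuousAt.2 fun x => (hd1 x).continuousAt
  have hhc1 : Continuous h' := continuous_iff_continuousAt.2 fun x => (hd2 x).continuousAt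
  set K := B * (1 + 5 * M + 2 * M ^ 2) with hK
  have hK0 : 0 ≤ K := by positivity
  refine ⟨K / d + (K / d + K), fun n hn ξ => ?_⟩
  have hn0 : (0 : ℝ) < n := by exact_mod_cast hn
  have hn1 : (1 : ℝ) ≤ n := by exact_mod_cast hn
  let φ : ℝ → ℂ := fun x => h x * plateau n x
  let φ₁ : ℝ → ℂ := fun x => h' x * (S (n * x) * S (n - x) : ℝ)
    + h x * (n * S₁ (n * x) * S (n - x) - S (n * x) * S₁ (n - x) : ℝ)
  let φ₂ : ℝ → ℂ := fun x => h'' x * (S (n * x) * S (n - x) : ℝ)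
    + 2 * (h' x * (n * S₁ (n * x) * S (n - x) - S (n * x) * S₁ (n - x) : ℝ))
    + h x * (n ^ 2 * S₂ (n * x) * S (n - x) - 2 * n * S₁ (n * x) * S₁ (n - x)
        + S (n * x) * S₂ (n - x) : ℝ)
  have a1 : ∀ x : ℝ, HasDerivAt (fun x : ℝ => (n : ℝ) * x) n x := fun x => by
    simpa using (hasDerivAt_id x).const_mul (n : ℝ)
  have a2 : ∀ x : ℝ, HasDerivAt (fun x : ℝ => (n : ℝ) - x) (-1) x := fun x =>
    (hasDerivAt_id x).const_sub (n : ℝ)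
  have s1 : ∀ x : ℝ, HasDerivAt (fun x : ℝ => S (n * x)) (S₁ (n * x) * n) x := fun x =>
    (hS1 _).comp x (a1 x)
  have s2 : ∀ x : ℝ, HasDerivAt (fun x : ℝ => S (n - x)) (S₁ (n - x) * (-1)) x := fun x =>
    (hS1 _).comp x (a2 x)
  have t1 : ∀ x : ℝ, HasDerivAt (fun x : ℝ => S₁ (n * x)) (S₂ (n * x) * n) x := fun x =>
    (hS2 _).comp x (a1 x)
  have t2 : ∀ x : ℝ, HasDerivAt (fun x : ℝ => S₁ (n - x)) (S₂ (n - x) * (-1)) x := fun x =>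
    (hS2 _).comp x (a2 x)
  have d1 : ∀ x, HasDerivAt φ (φ₁ x) x := fun x => by
    refine ((hd1 x).mul ((s1 x).mul (s2 x)).ofReal_comp).congr_deriv ?_
    simp only [φ₁, Pi.mul_apply]
    push_cast
    ring
  have d2 : ∀ x, HasDerivAt φ₁ (φ₂ x) x := fun x => by
    refine (((hd2 x).mul ((s1 x).mul (s2 x)).ofReal_comp).add ((hd1 x).mul
      ((((t1 x).const_mul (n : ℝ)).mul (s2 x)).sub ((s1 x).mul (t2 x))).ofReal_comp)).congr_deriv ?_
    simp only [φ₂, Pi.mul_apply, Pi.sub_apply]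
    push_cast
    ring
  have out : ∀ x, x ∉ Icc (0 : ℝ) n → S (n * x) * S (n - x) = 0 ∧ S₁ (n * x) * S (n - x) = 0 ∧
      S (n * x) * S₁ (n - x) = 0 := by
    intro x hx
    rcases lt_or_ge x 0 with hx0 | hx0
    · have h1 : (n : ℝ) * x < 0 := mul_neg_of_pos_of_neg hn0 hx0
      simp [S, Real.smoothTransition.zero_of_nonpos h1.le, (hneg _ h1).1]
    · have h1 : (n : ℝ) - x < 0 := by
        by_contra! h'
        exact hx ⟨hx0, by linarith⟩
      simp [S, Real.smoothTransition.zero_of_nonpos h1.le, (hneg _ h1).1]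
  have out2 : ∀ x, x ∉ Icc (0 : ℝ) n → S₂ (n * x) * S (n - x) = 0 ∧ S₁ (n * x) * S₁ (n - x) = 0 ∧
      S (n * x) * S₂ (n - x) = 0 := by
    intro x hx
    rcases lt_or_ge x 0 with hx0 | hx0
    · have h1 : (n : ℝ) * x < 0 := mul_neg_of_pos_of_neg hn0 hx0
      simp [S, Real.smoothTransition.zero_of_nonpos h1.le, hneg _ h1]
    · have h1 : (n : ℝ) - x < 0 := by
        by_contra! h'
        exact hx ⟨hx0, by linarith⟩
      simp [S, Real.smoothTransition.zero_of_nonpos h1.le, hneg _ h1]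
  have i0 : Integrable φ := by
    refine Continuous.integrable_of_hasCompactSupport ?_ ?_
    · exact continuous_iff_continuousAt.2 fun x => (d1 x).continuousAt
    · exact ((hasCompactSupport_plateau n).comp_left (g := ((↑) : ℝ → ℂ)) rfl).mul_left
  have i1 : Integrable φ₁ := by
    refine Continuous.integrable_of_hasCompactSupport ?_ ?_
    · exact continuous_iff_continuousAt.2 fun x => (d2 x).continuousAt
    · refine HasCompactSupport.intro (isCompact_Icc (a := (0 : ℝ)) (b := n)) fun x hx => ?_
      obtain ⟨o1, o2, o3⟩ := out x hx
      simp only [φ₁, mul_assoc, o1, o2, o3]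
      simp
  have i2 : Integrable φ₂ := by
    refine Continuous.integrable_of_hasCompactSupport ?_ ?_
    · simp only [φ₂]
      fun_prop
    · refine HasCompactSupport.intro (isCompact_Icc (a := (0 : ℝ)) (b := n)) fun x hx => ?_
      obtain ⟨o1, o2, o3⟩ := out x hx
      obtain ⟨p1, p2, p3⟩ := out2 x hx
      simp only [φ₂, mul_assoc, o1, o2, o3, p1, p2, p3]
      simp
  have ie : Integrable ((Ici (0 : ℝ)).indicator fun x => K * Real.exp (-d * x)) := by
    rw [integrable_indicator_iff measurableSet_Ici, integrableOn_Ici_iff_integrableOn_Ioi]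
    exact (exp_neg_integrableOn_Ioi 0 hd).const_mul K
  have ve : ∫ x, (Ici (0 : ℝ)).indicator (fun x => K * Real.exp (-d * x)) x = K / d := by
    rw [integral_indicator measurableSet_Ici, integral_Ici_eq_integral_Ioi,
      integral_const_mul, integral_exp_mul_Ioi (by linarith)]
    simp
    field_simp
  have ic : Integrable ((Icc (0 : ℝ) (1 / n)).indicator fun _ => K * n) := by
    rw [integrable_indicator_iff measurableSet_Icc]
    exact integrableOn_const (by simp)
  have vc : ∫ x, (Icc (0 : ℝ) (1 / n)).indicator (fun _ => K * n) x = K := by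
    rw [integral_indicator measurableSet_Icc, setIntegral_const]
    simp
    field_simp
  refine norm_FT_le_of_deriv_two d1 d2 i0 i1 i2 (A := K / d) (B := K / d + K) ?_ ?_ ξ
  · rw [← ve]
    refine integral_mono i0.norm ie fun x => ?_
    rcases lt_or_ge x 0 with hx | hx
    · simp [φ, plateau_of_nonpos n hx.le, hx]
    · rw [indicator_of_mem (show x ∈ Ici (0 : ℝ) from hx)]
      simp only [φ, norm_mul, Complex.norm_real, Real.norm_eq_abs]
      calc ‖h x‖ * |plateau n x| ≤ B * Real.exp (-d * x) * 1 :=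
            mul_le_mul (hB x hx) (abs_plateau_le n x) (abs_nonneg _) (by positivity)
        _ ≤ K * Real.exp (-d * x) := by
            rw [mul_one]
            refine mul_le_mul_of_nonneg_right ?_ (Real.exp_pos _).le
            rw [hK]
            exact le_mul_of_one_le_right hB0' (by nlinarith)
  · have vs := integral_add ie ic
    rw [ve, vc] at vs
    rw [← vs]
    refine integral_mono i2.norm (ie.add ic) fun x => ?_
    by_cases hxI : x ∉ Icc (0 : ℝ) n
    · obtain ⟨o1, o2, o3⟩ := out x hxI
      obtain ⟨p1, p2, p3⟩ := out2 x hxI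
      simp only [φ₂, mul_assoc, o1, o2, o3, p1, p2, p3]
      simp only [mul_zero, sub_zero, add_zero, Complex.ofReal_zero, norm_zero]
      refine add_nonneg (indicator_nonneg (fun _ _ => by positivity) _)
        (indicator_nonneg (fun _ _ => by positivity) _)
    · push Not at hxI
      have hx := hxI.1
      rw [indicator_of_mem (show x ∈ Ici (0 : ℝ) from hx)]
      set E := Real.exp (-d * x)
      have hE : 0 < E := Real.exp_pos _
      have u1 : |S (n * x) * S (n - x)| ≤ 1 := by
        rw [abs_mul]; exact mul_le_one₀ (hSb _) (abs_nonneg _) (hSb _)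
      have u2 : |S₁ (n * x) * S (n - x)| ≤ M := by
        rw [abs_mul]
        exact (mul_le_mul (hb1 _) (hSb _) (abs_nonneg _) hM0).trans_eq (mul_one M)
      have u3 : |S (n * x) * S₁ (n - x)| ≤ M := by
        rw [abs_mul]
        exact (mul_le_mul (hSb _) (hb1 _) (abs_nonneg _) zero_le_one).trans_eq (one_mul M)
      have u4 : |S₂ (n * x) * S (n - x)| ≤ M := by
        rw [abs_mul]
        exact (mul_le_mul (hb2 _) (hSb _) (abs_nonneg _) hM0).trans_eq (mul_one M)
      have u5 : |S₁ (n * x) * S₁ (n - x)| ≤ M ^ 2 := by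
        rw [abs_mul, sq]
        exact mul_le_mul (hb1 _) (hb1 _) (abs_nonneg _) hM0
      have u6 : |S (n * x) * S₂ (n - x)| ≤ M := by
        rw [abs_mul]
        exact (mul_le_mul (hSb _) (hb2 _) (abs_nonneg _) zero_le_one).trans_eq (one_mul M)
      have hsplit : ‖φ₂ x‖ ≤ ‖h'' x‖ * |S (n * x) * S (n - x)|
          + 2 * (‖h' x‖ * |n * S₁ (n * x) * S (n - x) - S (n * x) * S₁ (n - x)|)
          + ‖h x‖ * |n ^ 2 * S₂ (n * x) * S (n - x) - 2 * n * S₁ (n * x) * S₁ (n - x)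
            + S (n * x) * S₂ (n - x)| := by
        refine (norm_add₃_le).trans_eq ?_
        rw [abs_mul (S (n * x))]
        simp only [norm_mul, Complex.norm_real, Real.norm_eq_abs, Complex.norm_ofNat]
      have w1 : ‖h'' x‖ * |S (n * x) * S (n - x)| ≤ B * E :=
        (mul_le_mul (hB2 x hx) u1 (abs_nonneg _) (by positivity)).trans_eq (mul_one _)
      have hBE : 0 ≤ B * E := by positivity
      rcases lt_or_ge 1 ((n : ℝ) * x) with hnx | hnx
      · obtain ⟨z1, z2⟩ := hgt _ hnx
        have v1 : |n * S₁ (n * x) * S (n - x) - S (n * x) * S₁ (n - x)| ≤ M := by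
          rw [z1]; simpa [abs_neg] using u3
        have v2 : |n ^ 2 * S₂ (n * x) * S (n - x) - 2 * n * S₁ (n * x) * S₁ (n - x)
            + S (n * x) * S₂ (n - x)| ≤ M := by
          rw [z1, z2]; simpa using u6
        have w2 := mul_le_mul (hB1 x hx) v1 (abs_nonneg _) hBE
        have w3 := mul_le_mul (hB x hx) v2 (abs_nonneg _) hBE
        have w4 : 0 ≤ (Icc (0 : ℝ) (1 / n)).indicator (fun _ => K * (n : ℝ)) x :=
          indicator_nonneg (fun _ _ => by positivity) _
        have : 0 ≤ B * E * (2 * M + 2 * M ^ 2) := by positivity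
        rw [hK] at *
        linarith
      · have hxn : x ∈ Icc (0 : ℝ) (1 / n) := ⟨hx, by rw [le_div_iff₀ hn0]; linarith⟩
        rw [indicator_of_mem hxn]
        have hE1 : E ≤ 1 := Real.exp_le_one_iff.2 (by nlinarith)
        have v1 : |n * S₁ (n * x) * S (n - x) - S (n * x) * S₁ (n - x)| ≤ n * M + M := by
          refine (abs_sub _ _).trans (add_le_add ?_ u3)
          rw [mul_assoc, abs_mul, abs_of_pos hn0]
          exact mul_le_mul_of_nonneg_left u2 hn0.le
        have v2 : |n ^ 2 * S₂ (n * x) * S (n - x) - 2 * n * S₁ (n * x) * S₁ (n - x)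
            + S (n * x) * S₂ (n - x)| ≤ n ^ 2 * M + (2 * n * M ^ 2 + M) := by
          refine (abs_add_le _ _).trans ?_
          rw [← add_assoc]
          refine add_le_add ((abs_sub _ _).trans (add_le_add ?_ ?_)) u6
          · rw [mul_assoc, abs_mul, abs_of_pos (by positivity)]
            exact mul_le_mul_of_nonneg_left u4 (by positivity)
          · rw [mul_assoc, abs_mul, abs_of_pos (by positivity)]
            exact mul_le_mul_of_nonneg_left u5 (by positivity)
        have w2 := mul_le_mul (hB1 x hx) v1 (abs_nonneg _) hBE
        have w3 := mul_le_mul_of_nonneg_left v2 (norm_nonneg (h x))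
        have w4 : ‖h x‖ * (n ^ 2 * M) ≤ B * n * M := by
          calc ‖h x‖ * (n ^ 2 * M) ≤ (B * x) * (n ^ 2 * M) :=
                mul_le_mul_of_nonneg_right (hB0 x hx) (by positivity)
            _ = (B * n * M) * (n * x) := by ring
            _ ≤ (B * n * M) * 1 := mul_le_mul_of_nonneg_left hnx (by positivity)
            _ = _ := mul_one _
        have w5 := mul_le_mul_of_nonneg_right (hB x hx)
          (show 0 ≤ 2 * n * M ^ 2 + M by positivity)
        have w6 : B * E * (2 * n * M ^ 2) ≤ B * (2 * n * M ^ 2) :=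
          mul_le_mul_of_nonneg_right (mul_le_of_le_one_right hB0' hE1) (by positivity)
        have w7 : B * E * (n * M) ≤ B * (n * M) :=
          mul_le_mul_of_nonneg_right (mul_le_of_le_one_right hB0' hE1) (by positivity)
        have w8 : 0 ≤ B * E * (2 * M + 2 * M ^ 2) := by positivity
        have w9 : 0 ≤ B * n * (1 + 2 * M) := by positivity
        rw [hK]
        linarith

lemma norm_cexp_mul_ofReal_le {α : ℂ} {d : ℝ} (hα : α.re ≤ -d) {x : ℝ} (hx : 0 ≤ x) :
    ‖Complex.exp (α * x)‖ ≤ Real.exp (-d * x) := by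
  rw [Complex.norm_exp, Real.exp_le_exp, Complex.re_mul_ofReal]
  exact mul_le_mul_of_nonneg_right hα hx

lemma hasDerivAt_cexp_mul_ofReal (α : ℂ) (x : ℝ) :
    HasDerivAt (fun x : ℝ => Complex.exp (α * x)) (α * Complex.exp (α * x)) x := by
  have h1 : HasDerivAt (fun x : ℝ => α * (x : ℂ)) α x := by
    simpa using (Complex.ofRealCLM.hasDerivAt (x := x)).const_mul α
  exact h1.cexp.congr_deriv (mul_comm _ _)

lemma exists_FT_exp_plateau_bound {α β : ℂ} {d : ℝ} (hd : 0 < d) (hα : α.re ≤ -d)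
    (hβ : β.re ≤ -d) :
    ∃ C, ∀ n : ℕ, 0 < n → ∀ ξ,
      ‖FT (fun x => (Complex.exp (α * x) - Complex.exp (β * x)) * plateau n x) ξ‖
        ≤ C * (1 + ξ ^ 2)⁻¹ := by
  have key : ∀ (p q : ℂ) (P Q x : ℝ), 0 ≤ x → ‖p‖ ≤ P → ‖q‖ ≤ Q →
      ‖p * Complex.exp (α * x) - q * Complex.exp (β * x)‖ ≤ (P + Q) * Real.exp (-d * x) := by
    intro p q P Q x hx hp hq
    refine (norm_sub_le _ _).trans ?_
    rw [norm_mul, norm_mul, add_mul]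
    exact add_le_add
      (mul_le_mul hp (norm_cexp_mul_ofReal_le hα hx) (norm_nonneg _) ((norm_nonneg _).trans hp))
      (mul_le_mul hq (norm_cexp_mul_ofReal_le hβ hx) (norm_nonneg _) ((norm_nonneg _).trans hq))
  set B : ℝ := 2 + (‖α‖ + ‖β‖) + (‖α‖ ^ 2 + ‖β‖ ^ 2) with hB
  have hd1 : ∀ x : ℝ, HasDerivAt (fun x : ℝ => Complex.exp (α * x) - Complex.exp (β * x))
      (α * Complex.exp (α * x) - β * Complex.exp (β * x)) x := fun x =>
    (hasDerivAt_cexp_mul_ofReal α x).sub (hasDerivAt_cexp_mul_ofReal β x)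
  have hd2 : ∀ x : ℝ, HasDerivAt (fun x : ℝ => α * Complex.exp (α * x) - β * Complex.exp (β * x))
      (α ^ 2 * Complex.exp (α * x) - β ^ 2 * Complex.exp (β * x)) x := fun x =>
    (((hasDerivAt_cexp_mul_ofReal α x).const_mul α).sub
      ((hasDerivAt_cexp_mul_ofReal β x).const_mul β)).congr_deriv (by ring)
  have hB1 : ∀ x : ℝ, 0 ≤ x → ‖α * Complex.exp (α * x) - β * Complex.exp (β * x)‖
      ≤ B * Real.exp (-d * x) := fun x hx =>
    (key α β _ _ x hx le_rfl le_rfl).trans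
      (mul_le_mul_of_nonneg_right (by rw [hB]; nlinarith [sq_nonneg ‖α‖, sq_nonneg ‖β‖])
        (Real.exp_pos _).le)
  refine exists_FT_plateau_bound hd1 hd2 (by fun_prop) hd (B := B) ?_ hB1 ?_ ?_
  · intro x hx
    have := key 1 1 1 1 x hx (by simp) (by simp)
    simp only [one_mul] at this
    refine this.trans (mul_le_mul_of_nonneg_right ?_ (Real.exp_pos _).le)
    rw [hB]; nlinarith [sq_nonneg ‖α‖, sq_nonneg ‖β‖, norm_nonneg α, norm_nonneg β]
  · intro x hx
    have := key (α ^ 2) (β ^ 2) _ _ x hx (norm_pow _ 2).le (norm_pow _ 2).le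
    refine this.trans (mul_le_mul_of_nonneg_right ?_ (Real.exp_pos _).le)
    rw [hB]; nlinarith [sq_nonneg ‖α‖, sq_nonneg ‖β‖, norm_nonneg α, norm_nonneg β]
  · intro x hx
    have hB0 : 0 ≤ B := by positivity
    have := (convex_Ici (0 : ℝ)).norm_image_sub_le_of_norm_hasDerivWithin_le (C := B)
      (fun y _ => (hd1 y).hasDerivWithinAt) (fun y hy => (hB1 y hy).trans
        (mul_le_of_le_one_right hB0 (Real.exp_le_one_iff.2 (by
          have : (0 : ℝ) ≤ y := hy
          nlinarith)))) (show (0 : ℝ) ∈ Ici (0 : ℝ) from self_mem_Ici) (show x ∈ Ici (0 : ℝ) from hx)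
    simpa [abs_of_nonneg hx] using this

lemma tendsto_FT_exp_plateau {z w : ℂ} (hz : 0 < z.im) (hw : 0 < w.im) (ξ : ℝ) :
    Tendsto (fun n : ℕ => FT (fun x => (Complex.exp (2 * Real.pi * Complex.I * z * x)
      - Complex.exp (2 * Real.pi * Complex.I * w * x)) * plateau n x) ξ) atTop
      (𝓝 (-(1 / (2 * Real.pi * Complex.I)) * (1 / (z - ξ) - 1 / (w - ξ)))) := by
  have re_eq : ∀ u : ℂ, (2 * Real.pi * Complex.I * (u - ξ)).re = -(2 * Real.pi * u.im) := by
    intro u; simp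
  have int : ∀ u : ℂ, 0 < u.im → IntegrableOn
      (fun x : ℝ => Complex.exp (2 * Real.pi * Complex.I * (u - ξ) * x)) (Ioi 0) := fun u hu =>
    integrableOn_exp_mul_complex_Ioi (by rw [re_eq]; have := Real.pi_pos; simp; positivity) 0
  have val : ∀ u : ℂ, 0 < u.im →
      ∫ x : ℝ in Ioi 0, Complex.exp (2 * Real.pi * Complex.I * (u - ξ) * x)
        = -(1 / (2 * Real.pi * Complex.I)) * (1 / (u - ξ)) := fun u hu => by
    rw [integral_exp_mul_complex_Ioi (by rw [re_eq]; have := Real.pi_pos; simp; positivity) 0]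
    rw [Complex.ofReal_zero, mul_zero, Complex.exp_zero, neg_mul, one_div_mul_one_div, neg_div]
  rw [mul_sub, ← val z hz, ← val w hw, ← integral_sub (int z hz) (int w hw),
    ← integral_indicator measurableSet_Ioi]
  refine tendsto_integral_of_dominated_convergence
    ((Ioi (0 : ℝ)).indicator fun x : ℝ => ‖Complex.exp (2 * Real.pi * Complex.I * (z - ξ) * x)
      - Complex.exp (2 * Real.pi * Complex.I * (w - ξ) * x)‖) (fun n => ?_) ?_ (fun n => ?_) ?_
  · have := (contDiff_plateau n).continuous
    exact Continuous.aestronglyMeasurable (by fun_prop)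
  · rw [integrable_indicator_iff measurableSet_Ioi]
    exact ((int z hz).sub (int w hw)).norm
  all_goals
    have comb : ∀ x : ℝ, ∀ t : ℂ, (Complex.exp (2 * Real.pi * Complex.I * z * x)
        - Complex.exp (2 * Real.pi * Complex.I * w * x)) * t *
          Complex.exp (-(2 * Real.pi * Complex.I * x * ξ))
        = (Complex.exp (2 * Real.pi * Complex.I * (z - ξ) * x)
      - Complex.exp (2 * Real.pi * Complex.I * (w - ξ) * x)) * t := by
      intro x t
      have : ∀ u : ℂ, Complex.exp (2 * Real.pi * Complex.I * (u - ξ) * x)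
          = Complex.exp (2 * Real.pi * Complex.I * u * x)
            * Complex.exp (-(2 * Real.pi * Complex.I * x * ξ)) := fun u => by
        rw [← Complex.exp_add]; congr 1; ring
      rw [this, this]; ring
    refine Eventually.of_forall fun x => ?_
    simp only [comb]
    rcases le_or_gt x 0 with hx | hx
    · simp [plateau_of_nonpos _ hx, hx]
    rw [indicator_of_mem (show x ∈ Ioi (0 : ℝ) from hx)]
  · rw [norm_mul, Complex.norm_real, Real.norm_eq_abs]
    exact mul_le_of_le_one_right (norm_nonneg _) (abs_plateau_le n x)
  · refine tendsto_const_nhds.congr' ?_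
    filter_upwards [eventually_plateau_eq_one hx] with n hn
    rw [hn]; simp

/-- The summation formula tested against differences of one-sided exponentials. -/
lemma PoissonSum.tsum_cauchy {ι : Type*} {g : ι → ℝ} {a : ℝ → ℂ} (h : PoissonSum g a)
    (hs : Summable fun i => (1 + g i ^ 2)⁻¹) {d : ℝ} (hd : 0 < d)
    (ha : Summable fun l : ℝ => ‖a l‖ * Real.exp (-d * |l|)) {z w : ℂ}
    (hz : d ≤ 2 * Real.pi * z.im) (hw : d ≤ 2 * Real.pi * w.im) :
    ∑' i, (1 / (z - g i) - 1 / (w - g i)) = -(2 * Real.pi * Complex.I) *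
      ∑' l : ℝ, (Ioi (0 : ℝ)).indicator (fun l : ℝ => a l *
        (Complex.exp (2 * Real.pi * Complex.I * z * l)
          - Complex.exp (2 * Real.pi * Complex.I * w * l))) l := by
  have hz0 : 0 < z.im := pos_of_mul_pos_right (hd.trans_le hz) (by positivity)
  have hw0 : 0 < w.im := pos_of_mul_pos_right (hd.trans_le hw) (by positivity)
  have hαz : (2 * Real.pi * Complex.I * z).re ≤ -d := by simp; linarith
  have hαw : (2 * Real.pi * Complex.I * w).re ≤ -d := by simp; linarith
  obtain ⟨C, hC⟩ := exists_FT_exp_plateau_bound hd hαz hαw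
  set φ : ℕ → ℝ → ℂ := fun n x => (Complex.exp (2 * Real.pi * Complex.I * z * x)
      - Complex.exp (2 * Real.pi * Complex.I * w * x)) * plateau n x with hφ
  have hsum : ∀ n, ∑' i, FT (φ n) (g i) = ∑' l : ℝ, a l * φ n l := fun n => by
    refine (h (φ n) ?_ ?_).tsum_eq
    · have h1 : ContDiff ℝ (⊤ : ℕ∞) (fun x : ℝ => (x : ℂ)) := Complex.ofRealCLM.contDiff
      have h2 : ContDiff ℝ (⊤ : ℕ∞) (fun x : ℝ => (plateau n x : ℂ)) := h1.comp (contDiff_plateau n)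
      exact (((contDiff_const.mul h1).cexp).sub ((contDiff_const.mul h1).cexp)).mul h2
    · exact ((hasCompactSupport_plateau n).comp_left (g := ((↑) : ℝ → ℂ)) rfl).mul_left
  have l1 : Tendsto (fun n => ∑' i, FT (φ n) (g i)) atTop
      (𝓝 (∑' i, -(1 / (2 * Real.pi * Complex.I)) * (1 / (z - g i) - 1 / (w - g i)))) := by
    refine tendsto_tsum_of_dominated_convergence (hs.mul_left C)
      (fun i => tendsto_FT_exp_plateau hz0 hw0 (g i)) ?_
    filter_upwards [eventually_gt_atTop 0] with n hn i using hC n hn (g i)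
  have l2 : Tendsto (fun n => ∑' l : ℝ, a l * φ n l) atTop
      (𝓝 (∑' l : ℝ, (Ioi (0 : ℝ)).indicator (fun l : ℝ => a l *
        (Complex.exp (2 * Real.pi * Complex.I * z * l)
          - Complex.exp (2 * Real.pi * Complex.I * w * l))) l)) := by
    refine tendsto_tsum_of_dominated_convergence (ha.mul_left 2) (fun l => ?_)
      (Eventually.of_forall fun n l => ?_)
    · rcases le_or_gt l 0 with hl | hl
      · simp [hφ, plateau_of_nonpos _ hl, hl]
      rw [indicator_of_mem (show l ∈ Ioi (0 : ℝ) from hl)]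
      refine tendsto_const_nhds.congr' ?_
      filter_upwards [eventually_plateau_eq_one hl] with n hn
      simp [hφ, hn]
    · rcases le_or_gt l 0 with hl | hl
      · simp only [hφ, plateau_of_nonpos n hl, Complex.ofReal_zero, mul_zero, norm_zero]
        positivity
      rw [abs_of_pos hl]
      have h1 := norm_cexp_mul_ofReal_le hαz hl.le
      have h2 := norm_cexp_mul_ofReal_le hαw hl.le
      simp only [hφ, norm_mul, Complex.norm_real, Real.norm_eq_abs]
      calc ‖a l‖ * (‖Complex.exp (2 * Real.pi * Complex.I * z * l)
            - Complex.exp (2 * Real.pi * Complex.I * w * l)‖ * |plateau n l|)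
          ≤ ‖a l‖ * ((Real.exp (-d * l) + Real.exp (-d * l)) * 1) := by
            refine mul_le_mul_of_nonneg_left (mul_le_mul ((norm_sub_le _ _).trans
              (add_le_add h1 h2)) (abs_plateau_le n l) (abs_nonneg _) (by positivity))
              (norm_nonneg _)
        _ = _ := by ring
  have e := tendsto_nhds_unique (l1.congr hsum) l2
  rw [← e, tsum_mul_left]
  have : (2 * Real.pi * Complex.I : ℂ) ≠ 0 := Complex.two_pi_I_ne_zero
  field_simp

/-- The pure frequency `z ↦ e^{2πiθz}`. -/
def freq (θ : ℝ) (z : ℂ) : ℂ := Complex.exp (2 * (Real.pi : ℂ) * Complex.I * (θ : ℂ) * z)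

lemma norm_freq (θ : ℝ) (z : ℂ) : ‖freq θ z‖ = Real.exp (-(2 * Real.pi * θ * z.im)) := by
  rw [freq, Complex.norm_exp]
  simp

lemma freq_mul (θ η : ℝ) : freq θ * freq η = freq (θ + η) := by
  funext z
  simp only [freq, Pi.mul_apply, ← Complex.exp_add]
  push_cast
  ring_nf

lemma freq_zero : freq 0 = 1 := by
  funext z; simp [freq]

/-- Trigonometric polynomials with frequencies in `S`. -/
def trigSpan (S : Set ℝ) : Submodule ℂ (ℂ → ℂ) := Submodule.span ℂ (freq '' S)

lemma trigSpan_mono {S T : Set ℝ} (h : S ⊆ T) : trigSpan S ≤ trigSpan T :=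
  Submodule.span_mono (image_mono h)

lemma freq_mem_trigSpan {S : Set ℝ} {θ : ℝ} (h : θ ∈ S) : freq θ ∈ trigSpan S :=
  Submodule.subset_span (mem_image_of_mem _ h)

lemma isTrigPoly_of_mem_trigSpan {S : Set ℝ} {f : ℂ → ℂ} (h : f ∈ trigSpan S) : IsTrigPoly f := by
  have h1 : f ∈ Submodule.span ℂ (range freq) :=
    Submodule.span_mono (image_subset_range _ _) h
  obtain ⟨c, rfl⟩ := Finsupp.mem_span_range_iff_exists_finsupp.1 h1
  refine ⟨c.support.card, fun n => c (c.support.equivFin.symm n),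
    fun n => (c.support.equivFin.symm n : ℝ), fun z => ?_⟩
  rw [Finsupp.sum, Finset.sum_apply, ← Finset.sum_coe_sort]
  exact (Equiv.sum_comp c.support.equivFin.symm
    (fun i : c.support => (c i • freq i) z)).symm

lemma trigSpan_mul {S T R : Set ℝ} (h : ∀ θ ∈ S, ∀ η ∈ T, θ + η ∈ R) {f g : ℂ → ℂ}
    (hf : f ∈ trigSpan S) (hg : g ∈ trigSpan T) : f * g ∈ trigSpan R := by
  have h1 := Submodule.mul_mem_mul hf hg
  rw [trigSpan, trigSpan, Submodule.span_mul_span] at h1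
  refine Submodule.span_mono ?_ h1
  rintro _ ⟨_, ⟨θ, hθ, rfl⟩, _, ⟨η, hη, rfl⟩, rfl⟩
  exact ⟨θ + η, h θ hθ η hη, (freq_mul θ η).symm⟩

lemma exists_bound_of_mem_trigSpan {S : Set ℝ} {V : Set ℂ}
    (h : ∀ θ ∈ S, ∃ C, ∀ z ∈ V, ‖freq θ z‖ ≤ C) {f : ℂ → ℂ} (hf : f ∈ trigSpan S) :
    ∃ C, ∀ z ∈ V, ‖f z‖ ≤ C := by
  induction hf using Submodule.span_induction with
  | mem x hx =>
    obtain ⟨θ, hθ, rfl⟩ := hx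
    exact h θ hθ
  | zero => exact ⟨0, fun z _ => by simp⟩
  | add x y _ _ hx hy =>
    obtain ⟨A, hA⟩ := hx
    obtain ⟨B, hB⟩ := hy
    exact ⟨A + B, fun z hz => (norm_add_le _ _).trans (add_le_add (hA z hz) (hB z hz))⟩
  | smul c x _ hx =>
    obtain ⟨A, hA⟩ := hx
    refine ⟨‖c‖ * A, fun z hz => ?_⟩
    rw [Pi.smul_apply, norm_smul]
    exact mul_le_mul_of_nonneg_left (hA z hz) (norm_nonneg _)

lemma norm_freq_le_one {θ : ℝ} {z : ℂ} (h : 0 ≤ θ * z.im) : ‖freq θ z‖ ≤ 1 := by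
  rw [norm_freq, Real.exp_le_one_iff, neg_nonpos, mul_assoc]
  have := Real.pi_pos
  positivity

lemma exists_bound_upper_of_mem_trigSpan {f : ℂ → ℂ} (hf : f ∈ trigSpan (Ici 0)) :
    ∃ C, ∀ z : ℂ, 0 ≤ z.im → ‖f z‖ ≤ C :=
  exists_bound_of_mem_trigSpan (V := {z : ℂ | 0 ≤ z.im})
    (fun _ hθ => ⟨1, fun _ hz => norm_freq_le_one (mul_nonneg hθ hz)⟩) hf

/-- `f` agrees with a trigonometric polynomial with frequencies in `[0, W]` up to
`O(e^{-2πW Im z})` on `Im z ≥ Y`. -/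
def TrigApprox (W Y : ℝ) (f : ℂ → ℂ) : Prop :=
  ∃ P ∈ trigSpan (Icc 0 W), ∃ C, ∀ z : ℂ, Y ≤ z.im →
    ‖f z - P z‖ ≤ C * Real.exp (-(2 * Real.pi * W * z.im))

lemma TrigApprox.of_bound {W Y C : ℝ} {f : ℂ → ℂ}
    (h : ∀ z : ℂ, Y ≤ z.im → ‖f z‖ ≤ C * Real.exp (-(2 * Real.pi * W * z.im))) :
    TrigApprox W Y f :=
  ⟨0, Submodule.zero_mem _, C, by simpa using h⟩

lemma TrigApprox.of_mem {W Y : ℝ} {f : ℂ → ℂ} (h : f ∈ trigSpan (Icc 0 W)) :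
    TrigApprox W Y f :=
  ⟨f, h, 0, by simp⟩

lemma TrigApprox.add {W Y : ℝ} {f g : ℂ → ℂ} (hf : TrigApprox W Y f) (hg : TrigApprox W Y g) :
    TrigApprox W Y (f + g) := by
  obtain ⟨P, hP, A, hA⟩ := hf
  obtain ⟨R, hR, B, hB⟩ := hg
  refine ⟨P + R, Submodule.add_mem _ hP hR, A + B, fun z hz => ?_⟩
  rw [Pi.add_apply, Pi.add_apply, add_sub_add_comm, add_mul]
  exact (norm_add_le _ _).trans (add_le_add (hA z hz) (hB z hz))

lemma TrigApprox.smul {W Y : ℝ} {f : ℂ → ℂ} (c : ℂ) (hf : TrigApprox W Y f) :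
    TrigApprox W Y (c • f) := by
  obtain ⟨P, hP, A, hA⟩ := hf
  refine ⟨c • P, Submodule.smul_mem _ c hP, ‖c‖ * A, fun z hz => ?_⟩
  rw [Pi.smul_apply, Pi.smul_apply, ← smul_sub, norm_smul, mul_assoc]
  exact mul_le_mul_of_nonneg_left (hA z hz) (norm_nonneg _)

lemma TrigApprox.sum {W Y : ℝ} {ι : Type*} (s : Finset ι) {f : ι → ℂ → ℂ}
    (hf : ∀ i ∈ s, TrigApprox W Y (f i)) : TrigApprox W Y (∑ i ∈ s, f i) :=
  Finset.sum_induction f (TrigApprox W Y) (fun _ _ => .add) (.of_mem (Submodule.zero_mem _)) hf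

lemma TrigApprox.of_mem_nonneg {W Y : ℝ} (hY : 0 ≤ Y) {f : ℂ → ℂ}
    (h : f ∈ trigSpan (Ici 0)) : TrigApprox W Y f := by
  induction h using Submodule.span_induction with
  | mem x hx =>
    obtain ⟨θ, hθ, rfl⟩ := hx
    rcases le_or_gt θ W with hW | hW
    · exact .of_mem (freq_mem_trigSpan ⟨hθ, hW⟩)
    · refine .of_bound (C := 1) fun z hz => ?_
      rw [norm_freq, one_mul, Real.exp_le_exp, neg_le_neg_iff]
      have := Real.pi_pos
      exact mul_le_mul_of_nonneg_right (by nlinarith) (hY.trans hz)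
  | zero => exact .of_mem (Submodule.zero_mem _)
  | add x y _ _ hx hy => exact hx.add hy
  | smul c x _ hx => exact hx.smul c

lemma TrigApprox.mul {W Y : ℝ} (hW : 0 ≤ W) (hY : 0 ≤ Y) {f g : ℂ → ℂ} (hf : TrigApprox W Y f)
    (hg : TrigApprox W Y g) : TrigApprox W Y (f * g) := by
  obtain ⟨P, hP, A, hA⟩ := hf
  obtain ⟨R, hR, B, hB⟩ := hg
  have hP0 : P ∈ trigSpan (Ici 0) := trigSpan_mono Icc_subset_Ici_self hP
  have hR0 : R ∈ trigSpan (Ici 0) := trigSpan_mono Icc_subset_Ici_self hR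
  obtain ⟨p, hp⟩ := exists_bound_upper_of_mem_trigSpan hP0
  obtain ⟨r, hr⟩ := exists_bound_upper_of_mem_trigSpan hR0
  have h1 : TrigApprox W Y ((f - P) * (g - R) + (f - P) * R + P * (g - R)) := by
    refine .of_bound (C := A * B + A * r + p * B) fun z hz => ?_
    obtain ⟨E, hE⟩ : ∃ E, E = Real.exp (-(2 * Real.pi * W * z.im)) := ⟨_, rfl⟩
    have hA := hA z hz
    have hB := hB z hz
    rw [← hE] at hA hB ⊢
    have hz0 : 0 ≤ z.im := hY.trans hz
    have hE1 : E ≤ 1 := by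
      rw [hE, Real.exp_le_one_iff, neg_nonpos]
      have := Real.pi_pos
      positivity
    have hE0 : 0 < E := hE ▸ Real.exp_pos _
    have hp0 : 0 ≤ p := (norm_nonneg _).trans (hp z hz0)
    have hA0 : 0 ≤ A := nonneg_of_mul_nonneg_left ((norm_nonneg _).trans hA) hE0
    have hB0 : 0 ≤ B := nonneg_of_mul_nonneg_left ((norm_nonneg _).trans hB) hE0
    simp only [Pi.add_apply, Pi.mul_apply, Pi.sub_apply]
    refine norm_add₃_le.trans ?_
    simp only [norm_mul]
    have hr0 : 0 ≤ r := (norm_nonneg _).trans (hr z hz0)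
    calc ‖f z - P z‖ * ‖g z - R z‖ + ‖f z - P z‖ * ‖R z‖ + ‖P z‖ * ‖g z - R z‖
        ≤ (A * E) * (B * 1) + (A * E) * r + p * (B * E) := by
          gcongr
          · exact hB.trans (mul_le_mul_of_nonneg_left hE1 hB0)
          · exact hr z hz0
          · exact hp z hz0
      _ = (A * B + A * r + p * B) * E := by ring
  have h2 := h1.add (TrigApprox.of_mem_nonneg (W := W) hY (trigSpan_mul
    (fun _ h _ h' => add_nonneg (mem_Ici.1 h) (mem_Ici.1 h')) hP0 hR0))
  have e : f * g = (f - P) * (g - R) + (f - P) * R + P * (g - R) + P * R := by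
    funext z
    simp only [Pi.add_apply, Pi.mul_apply, Pi.sub_apply]
    ring
  rwa [e]

lemma TrigApprox.pow {W Y : ℝ} (hW : 0 ≤ W) (hY : 0 ≤ Y) {f : ℂ → ℂ} (hf : TrigApprox W Y f)
    (n : ℕ) : TrigApprox W Y (f ^ n) := by
  induction n with
  | zero =>
    rw [pow_zero, ← freq_zero]
    exact .of_mem (freq_mem_trigSpan ⟨le_rfl, hW⟩)
  | succ n ih => rw [pow_succ]; exact ih.mul hW hY hf

lemma TrigApprox.cexp {W Y δ A : ℝ} (hW : 0 ≤ W) (hY : 0 ≤ Y) (hδ : 0 < δ) {f : ℂ → ℂ}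
    (hf : TrigApprox W Y f)
    (hb : ∀ z : ℂ, Y ≤ z.im → ‖f z‖ ≤ A * Real.exp (-(2 * Real.pi * δ * z.im))) :
    TrigApprox W Y (fun z => Complex.exp (f z)) := by
  obtain ⟨n, hn⟩ := exists_nat_ge (W / δ)
  rw [div_le_iff₀ hδ] at hn
  have h1 : TrigApprox W Y (∑ m ∈ Finset.range n, ((m.factorial : ℂ)⁻¹) • f ^ m) :=
    .sum _ fun m _ => (hf.pow hW hY m).smul _
  have h2 : TrigApprox W Y (fun z => Complex.exp (f z)
      - ∑ m ∈ Finset.range n, f z ^ m / m.factorial) := by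
    refine .of_bound (C := A ^ n * Real.exp A) fun z hz => ?_
    have hz0 : 0 ≤ z.im := hY.trans hz
    have hA0 : 0 ≤ A := nonneg_of_mul_nonneg_left ((norm_nonneg _).trans (hb z hz)) (Real.exp_pos _)
    have hA1 : ‖f z‖ ≤ A := (hb z hz).trans (mul_le_of_le_one_right hA0 (by
      rw [Real.exp_le_one_iff, neg_nonpos]
      have := Real.pi_pos
      positivity))
    refine (Complex.norm_exp_sub_sum_le_norm_mul_exp _ n).trans ?_
    have w1 : ‖f z‖ ^ n ≤ A ^ n * Real.exp (-(2 * Real.pi * W * z.im)) := by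
      refine (pow_le_pow_left₀ (norm_nonneg _) (hb z hz) n).trans ?_
      rw [mul_pow, ← Real.exp_nat_mul]
      refine mul_le_mul_of_nonneg_left (Real.exp_le_exp.2 ?_) (by positivity)
      have := mul_le_mul_of_nonneg_right hn (show 0 ≤ 2 * Real.pi * z.im by
        have := Real.pi_pos
        positivity)
      linarith
    calc ‖f z‖ ^ n * Real.exp ‖f z‖ ≤ (A ^ n * Real.exp (-(2 * Real.pi * W * z.im))) * Real.exp A :=
          mul_le_mul w1 (Real.exp_le_exp.2 hA1) (Real.exp_pos _).le (by positivity)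
      _ = _ := by ring
  convert h2.add h1 using 1
  funext z
  simp only [Pi.add_apply, Finset.sum_apply, Pi.smul_apply, Pi.pow_apply, smul_eq_mul]
  simp only [div_eq_inv_mul]
  ring

lemma norm_tsum_freq_le {c : ℝ → ℂ} {d W : ℝ} (hc : Summable fun l => ‖c l‖ * Real.exp (-d * l))
    (hW : ∀ l, c l ≠ 0 → W ≤ l) {z : ℂ} (hz : d ≤ 2 * Real.pi * z.im) :
    ‖∑' l, c l * freq l z‖ ≤ ((∑' l, ‖c l‖ * Real.exp (-d * l)) * Real.exp (d * W)) *
      Real.exp (-(2 * Real.pi * W * z.im)) := by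
  rw [mul_assoc, ← Real.exp_add]
  refine tsum_of_norm_bounded (hc.hasSum.mul_right _) fun l => ?_
  rw [norm_mul, norm_freq, mul_assoc ‖c l‖, ← Real.exp_add]
  by_cases h : c l = 0
  · simp [h]
  · refine mul_le_mul_of_nonneg_left (Real.exp_le_exp.2 ?_) (norm_nonneg _)
    nlinarith [hW l h]

lemma summable_mul_freq {c : ℝ → ℂ} {d : ℝ} (hc : Summable fun l => ‖c l‖ * Real.exp (-d * l))
    (h0 : ∀ l, c l ≠ 0 → 0 ≤ l) {z : ℂ} (hz : d ≤ 2 * Real.pi * z.im) :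
    Summable fun l => c l * freq l z := by
  refine hc.of_norm_bounded fun l => ?_
  rw [norm_mul, norm_freq]
  by_cases h : c l = 0
  · simp [h]
  · refine mul_le_mul_of_nonneg_left (Real.exp_le_exp.2 ?_) (norm_nonneg _)
    nlinarith [h0 l h]

/-- Dirichlet series with locally finite positive frequencies. -/
lemma TrigApprox.tsum {c : ℝ → ℂ} {d W Y : ℝ} (hc : Summable fun l => ‖c l‖ * Real.exp (-d * l))
    (h0 : ∀ l, c l ≠ 0 → 0 ≤ l) (hfin : LocFinSet (Function.support c))
    (hY : d ≤ 2 * Real.pi * Y) : TrigApprox W Y (fun z => ∑' l, c l * freq l z) := by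
  have hpi := Real.pi_pos
  have hS : (Function.support c ∩ Iic W).Finite := by
    refine (hfin (-1) (W + 1)).subset fun l hl => ⟨hl.1, ?_, ?_⟩
    · linarith [h0 l hl.1]
    · linarith [show l ≤ W from hl.2]
  set c₁ : ℝ → ℂ := (Iic W).indicator c with hc₁
  set c₂ : ℝ → ℂ := (Ioi W).indicator c with hc₂
  have hsp : ∀ l, c l = c₁ l + c₂ l := fun l => by
    rcases le_or_gt l W with h | h
    · simp [hc₁, hc₂, h]
    · simp [hc₁, hc₂, h, h.not_ge]
  have hle₁ : ∀ l, ‖c₁ l‖ ≤ ‖c l‖ := fun l => norm_indicator_le_norm_self _ _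
  have hle₂ : ∀ l, ‖c₂ l‖ ≤ ‖c l‖ := fun l => norm_indicator_le_norm_self _ _
  have hne₁ : ∀ l, c₁ l ≠ 0 → c l ≠ 0 := fun l h h' => h (by simpa [h'] using hle₁ l)
  have hne₂ : ∀ l, c₂ l ≠ 0 → c l ≠ 0 := fun l h h' => h (by simpa [h'] using hle₂ l)
  have hs₁ : Summable fun l => ‖c₁ l‖ * Real.exp (-d * l) :=
    hc.of_nonneg_of_le (fun l => by positivity)
      fun l => mul_le_mul_of_nonneg_right (hle₁ l) (Real.exp_pos _).le
  have hs₂ : Summable fun l => ‖c₂ l‖ * Real.exp (-d * l) :=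
    hc.of_nonneg_of_le (fun l => by positivity)
      fun l => mul_le_mul_of_nonneg_right (hle₂ l) (Real.exp_pos _).le
  have hd : ∀ z : ℂ, Y ≤ z.im → d ≤ 2 * Real.pi * z.im := fun z hz => by nlinarith
  have hmem : ∑ l ∈ hS.toFinset, c l • freq l ∈ trigSpan (Icc 0 W) := by
    refine Submodule.sum_mem _ fun l hl => Submodule.smul_mem _ _ (freq_mem_trigSpan ?_)
    obtain ⟨h1, h2⟩ := hS.mem_toFinset.1 hl
    exact ⟨h0 l h1, h2⟩
  refine ⟨∑ l ∈ hS.toFinset, c l • freq l, hmem,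
    (∑' l, ‖c₂ l‖ * Real.exp (-d * l)) * Real.exp (d * W), fun z hz => ?_⟩
  have e : ∑' l, c l * freq l z = ∑' l, c₁ l * freq l z + ∑' l, c₂ l * freq l z := by
    rw [← (summable_mul_freq hs₁ (fun l h => h0 l (hne₁ l h)) (hd z hz)).tsum_add
      (summable_mul_freq hs₂ (fun l h => h0 l (hne₂ l h)) (hd z hz))]
    exact tsum_congr fun l => by rw [hsp l, add_mul]
  have e1 : ∑' l, c₁ l * freq l z = (∑ l ∈ hS.toFinset, c l • freq l) z := by
    rw [Finset.sum_apply, tsum_eq_sum (s := hS.toFinset)]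
    · refine Finset.sum_congr rfl fun l hl => ?_
      have := (hS.mem_toFinset.1 hl).2
      rw [hc₁, indicator_of_mem this]
      rfl
    · intro l hl
      have : c₁ l = 0 := by
        by_contra h
        exact hl (hS.mem_toFinset.2 ⟨hne₁ l h, mem_of_indicator_ne_zero h⟩)
      rw [this, zero_mul]
  have e2 : ∑' l, c l * freq l z - (∑ l ∈ hS.toFinset, c l • freq l) z
      = ∑' l, c₂ l * freq l z := by rw [e, e1, add_sub_cancel_left]
  refine (congrArg norm e2).trans_le ?_
  exact norm_tsum_freq_le hs₂ (fun l h => (mem_of_indicator_ne_zero h : l ∈ Ioi W).le) (hd z hz)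

lemma hasDerivAt_freq (θ : ℝ) (z : ℂ) :
    HasDerivAt (freq θ) (2 * Real.pi * Complex.I * θ * freq θ z) z := by
  have h : HasDerivAt (fun z : ℂ => 2 * (Real.pi : ℂ) * Complex.I * (θ : ℂ) * z)
      (2 * Real.pi * Complex.I * θ) z := by
    simpa using (hasDerivAt_id z).const_mul (2 * (Real.pi : ℂ) * Complex.I * (θ : ℂ))
  exact h.cexp.congr_deriv (mul_comm _ _)

/-- The part of `a` on positive frequencies. -/
def posCoeff (a : ℝ → ℂ) : ℝ → ℂ := (Ioi (0 : ℝ)).indicator a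

/-- Coefficients of the primitive of `-2πi ∑_{λ > 0} a(λ) e^{2πiλz}`. -/
def primCoeff (a : ℝ → ℂ) (l : ℝ) : ℂ := -(posCoeff a l / l)

lemma posCoeff_ne_zero {a : ℝ → ℂ} {l : ℝ} (h : posCoeff a l ≠ 0) :
    l ∈ Function.support a ∧ 0 < l := by
  have h1 : l ∈ Ioi (0 : ℝ) := mem_of_indicator_ne_zero h
  refine ⟨?_, h1⟩
  rwa [posCoeff, indicator_of_mem h1] at h

lemma primCoeff_ne_zero {a : ℝ → ℂ} {l : ℝ} (h : primCoeff a l ≠ 0) :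
    l ∈ Function.support a ∧ 0 < l :=
  posCoeff_ne_zero fun h' => h (by simp [primCoeff, h'])

lemma summable_posCoeff {a : ℝ → ℂ} {d : ℝ}
    (ha : Summable fun l : ℝ => ‖a l‖ * Real.exp (-d * |l|)) :
    Summable fun l => ‖posCoeff a l‖ * Real.exp (-d * l) := by
  refine ha.of_nonneg_of_le (fun l => by positivity) fun l => ?_
  rcases le_or_gt l 0 with h | h
  · have : posCoeff a l = 0 := by simp [posCoeff, h]
    rw [this, norm_zero, zero_mul]
    positivity
  · rw [abs_of_pos h]
    exact mul_le_mul_of_nonneg_right (norm_indicator_le_norm_self _ _) (Real.exp_pos _).le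

lemma norm_primCoeff_le {a : ℝ → ℂ} {δ : ℝ} (hδ : 0 < δ)
    (hgap : ∀ x ∈ Function.support a, x ≠ 0 → δ ≤ |x|) (l : ℝ) :
    ‖primCoeff a l‖ ≤ δ⁻¹ * ‖posCoeff a l‖ := by
  by_cases h : posCoeff a l = 0
  · simp [primCoeff, h]
  · obtain ⟨h1, h2⟩ := posCoeff_ne_zero h
    have := hgap l h1 h2.ne'
    rw [abs_of_pos h2] at this
    rw [primCoeff, norm_neg, norm_div, Complex.norm_real, Real.norm_eq_abs, abs_of_pos h2,
      div_eq_inv_mul]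
    exact mul_le_mul_of_nonneg_right (inv_anti₀ hδ this) (norm_nonneg _)

lemma summable_primCoeff {a : ℝ → ℂ} {d δ : ℝ}
    (ha : Summable fun l : ℝ => ‖a l‖ * Real.exp (-d * |l|)) (hδ : 0 < δ)
    (hgap : ∀ x ∈ Function.support a, x ≠ 0 → δ ≤ |x|) :
    Summable fun l => ‖primCoeff a l‖ * Real.exp (-d * l) := by
  refine ((summable_posCoeff ha).mul_left δ⁻¹).of_nonneg_of_le (fun l => by positivity) fun l => ?_
  rw [← mul_assoc]
  exact mul_le_mul_of_nonneg_right (norm_primCoeff_le hδ hgap l) (Real.exp_pos _).le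

lemma hasDerivAt_tsum_primCoeff {a : ℝ → ℂ} {d δ : ℝ}
    (ha : Summable fun l : ℝ => ‖a l‖ * Real.exp (-d * |l|)) (hδ : 0 < δ)
    (hgap : ∀ x ∈ Function.support a, x ≠ 0 → δ ≤ |x|) {z : ℂ} (hz : d / (2 * Real.pi) < z.im) :
    HasDerivAt (fun z => ∑' l, primCoeff a l * freq l z)
      (-(2 * Real.pi * Complex.I) * ∑' l, posCoeff a l * freq l z) z := by
  have hpi := Real.pi_pos
  simp only [← tsum_mul_left]
  have hp := summable_posCoeff ha
  refine hasDerivAt_tsum_of_isPreconnected (g := fun l z => primCoeff a l * freq l z)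
    (g' := fun l z => -(2 * Real.pi * Complex.I) * (posCoeff a l * freq l z))
    (u := fun l => 2 * Real.pi * (‖posCoeff a l‖ * Real.exp (-d * l)))
    (t := {z : ℂ | d / (2 * Real.pi) < z.im}) (y₀ := z) (hp.mul_left _)
    (isOpen_lt continuous_const Complex.continuous_im)
    (convex_halfSpace_im_gt _).isPreconnected (fun l y _ => ?_) (fun l y hy => ?_) hz ?_ hz
  · refine ((hasDerivAt_freq l y).const_mul (primCoeff a l)).congr_deriv ?_
    by_cases h : posCoeff a l = 0
    · simp [primCoeff, h]
    · have : (l : ℂ) ≠ 0 := by exact_mod_cast (posCoeff_ne_zero h).2.ne'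
      rw [primCoeff]
      field_simp
  · rw [norm_mul, norm_mul, norm_freq, norm_neg]
    have e : ‖(2 * Real.pi * Complex.I : ℂ)‖ = 2 * Real.pi := by
      simp [abs_of_pos hpi]
    rw [e]
    by_cases h : posCoeff a l = 0
    · simp [h]
    · have hl := (posCoeff_ne_zero h).2
      refine mul_le_mul_of_nonneg_left (mul_le_mul_of_nonneg_left (Real.exp_le_exp.2 ?_)
        (norm_nonneg _)) (by positivity)
      have hy' : d < y.im * (2 * Real.pi) := (div_lt_iff₀ (by positivity)).1 hy
      nlinarith
  · refine summable_mul_freq (summable_primCoeff ha hδ hgap)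
      (fun l h => (primCoeff_ne_zero h).2.le) ?_
    have := (div_lt_iff₀ (by positivity)).1 hz
    linarith

lemma PoissonSum.exists_exp_repr {ι : Type*} {g : ι → ℝ} {a : ℝ → ℂ} (h : PoissonSum g a)
    (hs : Summable fun i => (1 + g i ^ 2)⁻¹) {c : ℝ} (hg : ∀ i, g i ≠ c) {d δ : ℝ} (hd : 0 < d)
    (ha : Summable fun l : ℝ => ‖a l‖ * Real.exp (-d * |l|)) (hδ : 0 < δ)
    (hgap : ∀ x ∈ Function.support a, x ≠ 0 → δ ≤ |x|) :
    ∃ C K : ℂ, ∀ z : ℂ, d / (2 * Real.pi) < z.im →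
      canonProd g c z = C * Complex.exp (K * z) *
        Complex.exp (∑' l, primCoeff a l * freq l z) := by
  have hpi := Real.pi_pos
  have hs' := summable_inv_sub_sq hs c
  set U : Set ℂ := {z : ℂ | d / (2 * Real.pi) < z.im} with hU
  set D : ℂ → ℂ := fun z => ∑' l, primCoeff a l * freq l z with hD
  set D' : ℂ → ℂ := fun z => -(2 * Real.pi * Complex.I) * ∑' l, posCoeff a l * freq l z with hD'
  have hUd : ∀ z ∈ U, d ≤ 2 * Real.pi * z.im := fun z hz => by
    have := (div_lt_iff₀ (by positivity)).1 (show d / (2 * Real.pi) < z.im from hz)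
    linarith
  have hUne : ∀ z ∈ U, ∀ i, z ≠ g i := fun z hz i h' => by
    have : d / (2 * Real.pi) < z.im := hz
    rw [h', Complex.ofReal_im] at this
    have : 0 < d / (2 * Real.pi) := by positivity
    linarith
  have hderiv : ∀ z ∈ U, HasDerivAt D (D' z) z := fun z hz =>
    hasDerivAt_tsum_primCoeff ha hδ hgap hz
  have hsf : ∀ z ∈ U, Summable fun l => posCoeff a l * freq l z := fun z hz =>
    summable_mul_freq (summable_posCoeff ha) (fun l h => (posCoeff_ne_zero h).2.le) (hUd z hz)
  have hlog : ∀ z ∈ U, ∀ w ∈ U, logDeriv (canonProd g c) z - logDeriv (canonProd g c) w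
      = D' z - D' w := by
    intro z hz w hw
    rw [logDeriv_canonProd hg hs' (hUne z hz), logDeriv_canonProd hg hs' (hUne w hw),
      ← (summable_canon_logDeriv hg hs' (hUne z hz)).tsum_sub
        (summable_canon_logDeriv hg hs' (hUne w hw))]
    have e1 := h.tsum_cauchy hs hd ha (hUd z hz) (hUd w hw)
    simp only [hD']
    rw [← mul_sub, ← (hsf z hz).tsum_sub (hsf w hw)]
    refine Eq.trans (tsum_congr fun i => by ring) (e1.trans ?_)
    congr 1
    refine tsum_congr fun l => ?_
    rcases le_or_gt l 0 with hl | hl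
    · simp [posCoeff, hl]
    · rw [posCoeff, indicator_of_mem (show l ∈ Ioi (0 : ℝ) from hl),
        indicator_of_mem (show l ∈ Ioi (0 : ℝ) from hl), freq, freq]
      ring_nf
  set w : ℂ := ((d / (2 * Real.pi) + 1 : ℝ) : ℂ) * Complex.I with hw
  have hwU : w ∈ U := by
    show d / (2 * Real.pi) < w.im
    rw [hw, Complex.im_ofReal_mul, Complex.I_im]
    linarith
  set K := logDeriv (canonProd g c) w - D' w with hK
  have hG : ∀ z ∈ U, HasDerivAt (fun z => canonProd g c z * Complex.exp (-(K * z + D z))) 0 z := by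
    intro z hz
    have hne : canonProd g c z ≠ 0 := fun h0 => by
      obtain ⟨i, hi⟩ := (canonProd_eq_zero hg hs' z).1 h0
      exact hUne z hz i hi
    have h1 := (differentiable_canonProd (g := g) (c := c) hs' z).hasDerivAt
    have h2 : HasDerivAt (fun z => -(K * z + D z)) (-(K + D' z)) z := by
      have := (((hasDerivAt_id z).const_mul K).add (hderiv z hz)).neg
      simpa using! this
    refine (h1.mul h2.cexp).congr_deriv ?_
    have h3 : deriv (canonProd g c) z = canonProd g c z * (K + D' z) := by
      have := hlog z hz w hwU
      rw [logDeriv_apply] at this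
      rw [hK, ← sub_eq_zero]
      field_simp at this
      linear_combination this
    rw [h3]
    ring
  have hUo : IsOpen U := isOpen_lt continuous_const Complex.continuous_im
  obtain ⟨C, hC⟩ := hUo.exists_is_const_of_deriv_eq_zero (convex_halfSpace_im_gt _).isPreconnected
    (fun z hz => (hG z hz).differentiableAt.differentiableWithinAt)
    (fun z hz => (hG z hz).deriv)
  refine ⟨C, K, fun z hz => ?_⟩
  rw [← hC z hz, mul_assoc, mul_assoc, ← Complex.exp_add, ← Complex.exp_add]
  simp [hD]

lemma differentiable_of_mem_trigSpan {S : Set ℝ} {f : ℂ → ℂ} (hf : f ∈ trigSpan S) :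
    Differentiable ℂ f := by
  induction hf using Submodule.span_induction with
  | mem x hx =>
    obtain ⟨θ, hθ, rfl⟩ := hx
    exact fun z => (hasDerivAt_freq θ z).differentiableAt
  | zero => exact differentiable_const 0
  | add x y _ _ hx hy => exact hx.add hy
  | smul c x _ hx => exact hx.const_smul c

/-- Phragmén–Lindelöf in a horizontal strip for functions of order at most two. -/
lemma norm_le_of_order_two_strip {f : ℂ → ℂ} (hf : Differentiable ℂ f) {Y A B C : ℝ} (hY : 0 < Y)
    (hB : 0 ≤ B) (hgr : ∀ z : ℂ, |z.im| ≤ Y → ‖f z‖ ≤ A * Real.exp (B * ‖z‖ ^ 2))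
    (hlo : ∀ z : ℂ, z.im = -Y → ‖f z‖ ≤ C) (hup : ∀ z : ℂ, z.im = Y → ‖f z‖ ≤ C)
    {z : ℂ} (hz : |z.im| ≤ Y) : ‖f z‖ ≤ C := by
  have hpi := Real.pi_pos
  obtain ⟨c, hc⟩ : ∃ c : ℝ, c = Real.pi / (4 * Y) := ⟨_, rfl⟩
  have hc0 : 0 < c := by rw [hc]; positivity
  refine PhragmenLindelof.horizontal_strip (a := -Y) (b := Y) hf.diffContOnCl
    ⟨c, ?_, B * (2 / c ^ 2), ?_⟩ hlo hup (neg_le_of_abs_le hz) (le_of_abs_le hz)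
  · rw [hc]
    exact div_lt_div_of_pos_left hpi (by linarith) (by linarith)
  · refine Asymptotics.IsBigO.of_bound (A * Real.exp (B * Y ^ 2)) ?_
    refine eventually_inf_principal.2 (Eventually.of_forall fun z hz => ?_)
    have hz1 : |z.im| ≤ Y := abs_le.2 ⟨hz.1.le, hz.2.le⟩
    have hA : 0 ≤ A := nonneg_of_mul_nonneg_left ((norm_nonneg _).trans (hgr z hz1))
      (Real.exp_pos _)
    rw [Real.norm_eq_abs, Real.abs_exp, mul_assoc, ← Real.exp_add]
    refine (hgr z hz1).trans (mul_le_mul_of_nonneg_left (Real.exp_le_exp.2 ?_) hA)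
    have h1 : ‖z‖ ^ 2 = |z.re| ^ 2 + |z.im| ^ 2 := by
      rw [← Complex.normSq_eq_norm_sq, Complex.normSq_apply, sq_abs, sq_abs]
      ring
    have h2 : |z.im| ^ 2 ≤ Y ^ 2 := pow_le_pow_left₀ (abs_nonneg _) hz1 2
    have h3 : |z.re| ^ 2 ≤ 2 / c ^ 2 * Real.exp (c * |z.re|) := by
      have := Real.quadratic_le_exp_of_nonneg (x := c * |z.re|) (by positivity)
      rw [div_mul_eq_mul_div, le_div_iff₀ (by positivity)]
      nlinarith [mul_nonneg hc0.le (abs_nonneg z.re)]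
    rw [h1, mul_assoc, ← mul_add]
    exact mul_le_mul_of_nonneg_left (by linarith) hB

/-- An entire function of order at most two, symmetric under conjugation, which behaves like
an exponential times an almost periodic function in a half-plane, is a trigonometric polynomial. -/
lemma mem_trigSpan_of_trigApprox {Q E : ℂ → ℂ} (hQ : Differentiable ℂ Q)
    (hconj : ∀ z, Q (starRingEnd ℂ z) = starRingEnd ℂ (Q z)) {A B Y β : ℝ} (hY : 0 < Y)
    (hB : 0 ≤ B) (hgr : ∀ z, |z.im| ≤ Y → ‖Q z‖ ≤ A * Real.exp (B * ‖z‖ ^ 2)) {C : ℂ}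
    (hrep : ∀ z : ℂ, Y ≤ z.im → Q z = C * freq β z * E z)
    (hE : ∀ W, 0 ≤ W → TrigApprox W Y E) : Q ∈ trigSpan univ := by
  have hpi := Real.pi_pos
  obtain ⟨W, hW0, hWβ⟩ : ∃ W : ℝ, 0 ≤ W ∧ -2 * β ≤ W := ⟨max 0 (-2 * β), le_max_left _ _,
    le_max_right _ _⟩
  obtain ⟨P, hP, C', hC'⟩ := hE W hW0
  have hP0 : P ∈ trigSpan (Ici 0) := trigSpan_mono Icc_subset_Ici_self hP
  have hPn : P * freq (-W) ∈ trigSpan (Iic 0) :=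
    trigSpan_mul (fun θ hθ η hη => by
      have h1 : η = -W := hη
      have h2 := hθ.2
      rw [mem_Iic]
      linarith) hP (freq_mem_trigSpan (mem_singleton (-W)))
  obtain ⟨p, hp⟩ := exists_bound_upper_of_mem_trigSpan hP0
  obtain ⟨q, hq⟩ := exists_bound_of_mem_trigSpan (V := {z : ℂ | z.im ≤ 0})
    (fun θ hθ => ⟨1, fun z hz => norm_freq_le_one (mul_nonneg_of_nonpos_of_nonpos hθ hz)⟩) hPn
  obtain ⟨M, hM⟩ : ∃ M, ∀ z : ℂ, Y ≤ z.im → ‖E z‖ ≤ M := by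
    refine ⟨|C'| + p, fun z hz => ?_⟩
    have h1 := hC' z hz
    have h2 := hp z (hY.le.trans hz)
    have h3 : Real.exp (-(2 * Real.pi * W * z.im)) ≤ 1 := by
      have := hY.le.trans hz
      rw [Real.exp_le_one_iff, neg_nonpos]
      positivity
    have h4 : C' * Real.exp (-(2 * Real.pi * W * z.im)) ≤ |C'| * 1 :=
      mul_le_mul (le_abs_self _) h3 (Real.exp_pos _).le (abs_nonneg _)
    calc ‖E z‖ = ‖(E z - P z) + P z‖ := by rw [sub_add_cancel]
      _ ≤ _ := (norm_add_le _ _).trans (by linarith)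
  set F : ℂ → ℂ := fun z => Q z * freq (-β) z with hF
  set H : ℂ → ℂ := fun z => (F z - C * P z) * freq (-W) z with hH
  have hfreq : ∀ θ z, freq θ z * freq (-θ) z = 1 := fun θ z => by
    rw [← Pi.mul_apply, freq_mul, add_neg_cancel, freq_zero, Pi.one_apply]
  have hfd : ∀ θ, Differentiable ℂ (freq θ) := fun θ z => (hasDerivAt_freq θ z).differentiableAt
  have hHd : Differentiable ℂ H :=
    ((hQ.mul (hfd _)).sub ((differentiable_of_mem_trigSpan hP).const_mul C)).mul (hfd _)
  have hup : ∀ z : ℂ, Y ≤ z.im → ‖H z‖ ≤ ‖C‖ * C' := by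
    intro z hz
    have e : H z = C * (E z - P z) * freq (-W) z := by
      simp only [hH, hF]
      rw [hrep z hz]
      linear_combination C * E z * freq (-W) z * hfreq β z
    rw [e, norm_mul, norm_mul, norm_freq, mul_assoc]
    refine mul_le_mul_of_nonneg_left ?_ (norm_nonneg _)
    calc ‖E z - P z‖ * Real.exp (-(2 * Real.pi * -W * z.im))
        ≤ C' * Real.exp (-(2 * Real.pi * W * z.im)) * Real.exp (-(2 * Real.pi * -W * z.im)) :=
          mul_le_mul_of_nonneg_right (hC' z hz) (Real.exp_pos _).le
      _ = C' := by rw [mul_assoc, ← Real.exp_add]; ring_nf; simp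
  have hlo : ∀ z : ℂ, z.im ≤ -Y → ‖H z‖ ≤ ‖C‖ * M + ‖C‖ * q := by
    intro z hz
    have e : H z = F z * freq (-W) z - C * (P * freq (-W)) z := by
      simp only [hH, Pi.mul_apply]
      ring
    rw [e]
    refine (norm_sub_le _ _).trans (add_le_add ?_ ?_)
    · have h1 : Y ≤ (starRingEnd ℂ z).im := by rw [Complex.conj_im]; linarith
      have h2 : ‖Q z‖ = ‖C‖ * ‖freq β (starRingEnd ℂ z)‖ * ‖E (starRingEnd ℂ z)‖ := by
        rw [← Complex.norm_conj (Q z), ← hconj, hrep _ h1, norm_mul, norm_mul]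
      simp only [hF]
      rw [norm_mul, norm_mul, h2, norm_freq, norm_freq, norm_freq, Complex.conj_im]
      calc ‖C‖ * Real.exp (-(2 * Real.pi * β * -z.im)) * ‖E (starRingEnd ℂ z)‖ *
            Real.exp (-(2 * Real.pi * -β * z.im)) * Real.exp (-(2 * Real.pi * -W * z.im))
          = ‖C‖ * ‖E (starRingEnd ℂ z)‖ * (Real.exp (-(2 * Real.pi * β * -z.im)) *
            Real.exp (-(2 * Real.pi * -β * z.im)) * Real.exp (-(2 * Real.pi * -W * z.im))) := by
              ring
        _ ≤ ‖C‖ * M * 1 := by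
            refine mul_le_mul (mul_le_mul_of_nonneg_left (hM _ h1) (norm_nonneg _)) ?_
              (by positivity) (mul_nonneg (norm_nonneg _) ((norm_nonneg _).trans (hM _ h1)))
            rw [← Real.exp_add, ← Real.exp_add, Real.exp_le_one_iff]
            have : 0 ≤ (2 * β + W) * -z.im := mul_nonneg (by linarith) (by linarith)
            nlinarith
        _ = _ := mul_one _
    · rw [norm_mul]
      exact mul_le_mul_of_nonneg_left (hq z (show z.im ≤ 0 by linarith)) (norm_nonneg _)
  set T := max (‖C‖ * C') (‖C‖ * M + ‖C‖ * q) with hT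
  have hstrip : ∀ θ : ℝ, ∀ z : ℂ, |z.im| ≤ Y → ‖freq θ z‖ ≤ Real.exp (2 * Real.pi * |θ| * Y) := by
    intro θ z hz
    rw [norm_freq, Real.exp_le_exp]
    calc -(2 * Real.pi * θ * z.im) ≤ |2 * Real.pi * θ * z.im| := neg_le_abs _
      _ = 2 * Real.pi * |θ| * |z.im| := by
          rw [abs_mul, abs_mul, abs_of_pos (by positivity : 0 < 2 * Real.pi)]
      _ ≤ _ := mul_le_mul_of_nonneg_left hz (by positivity)
  obtain ⟨r, hr⟩ := exists_bound_of_mem_trigSpan (V := {z : ℂ | |z.im| ≤ Y})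
    (fun θ _ => ⟨_, fun z hz => hstrip θ z hz⟩) hP
  have hbd : ∀ z, ‖H z‖ ≤ T := by
    intro z
    by_cases hz : |z.im| ≤ Y
    · refine norm_le_of_order_two_strip hHd hY hB (A := (A * Real.exp (2 * Real.pi * |-β| * Y)
        + ‖C‖ * r) * Real.exp (2 * Real.pi * |-W| * Y)) (fun u hu => ?_)
        (fun u hu => (hlo u hu.le).trans (le_max_right _ _))
        (fun u hu => (hup u hu.ge).trans (le_max_left _ _)) hz
      have h1 : 1 ≤ Real.exp (B * ‖u‖ ^ 2) := Real.one_le_exp (by positivity)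
      have hr0 : 0 ≤ r := (norm_nonneg _).trans (hr u hu)
      have h2 : ‖F u - C * P u‖ ≤ (A * Real.exp (B * ‖u‖ ^ 2)) *
          Real.exp (2 * Real.pi * |-β| * Y) + ‖C‖ * r * Real.exp (B * ‖u‖ ^ 2) := by
        refine (norm_sub_le _ _).trans (add_le_add ?_ ?_)
        · rw [hF, norm_mul]
          exact mul_le_mul (hgr u hu) (hstrip _ u hu) (norm_nonneg _)
            ((norm_nonneg _).trans (hgr u hu))
        · rw [norm_mul]
          exact (mul_le_mul_of_nonneg_left (hr u hu) (norm_nonneg _)).trans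
            (le_mul_of_one_le_right (by positivity) h1)
      rw [hH, norm_mul]
      refine (mul_le_mul h2 (hstrip _ u hu) (norm_nonneg _) ((norm_nonneg _).trans h2)).trans_eq ?_
      ring
    · rcases lt_abs.1 (not_le.1 hz) with h | h
      · exact (hup z h.le).trans (le_max_left _ _)
      · exact (hlo z (by linarith)).trans (le_max_right _ _)
  have hconst : ∀ z, H z = H 0 := fun z => hHd.apply_eq_apply_of_bounded
    ((Metric.isBounded_closedBall (x := (0 : ℂ)) (r := T)).subset (by
      rintro _ ⟨u, rfl⟩
      simpa using hbd u)) z 0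
  have hfin : Q = (C • P + H 0 • freq W) * freq β := by
    funext z
    have h1 := hconst z
    simp only [hH, hF] at h1
    simp only [Pi.mul_apply, Pi.add_apply, Pi.smul_apply, smul_eq_mul]
    have e1 := hfreq W z
    have e2 := hfreq β z
    have e3 : Q z * freq (-β) z - C * P z = H 0 * freq W z := by
      rw [← hconst z]
      simp only [hH, hF]
      linear_combination -(Q z * freq (-β) z - C * P z) * e1
    rw [← e3]
    linear_combination -(Q z) * e2
  rw [hfin]
  exact trigSpan_mul (fun _ _ _ _ => mem_univ _)
    (Submodule.add_mem _ (Submodule.smul_mem _ _ (trigSpan_mono (subset_univ _) hP))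
      (Submodule.smul_mem _ _ (freq_mem_trigSpan (mem_univ W))))
    (freq_mem_trigSpan (mem_univ β))

lemma LocFinSet.countable {S : Set ℝ} (hS : LocFinSet S) : S.Countable := by
  have h : S = ⋃ n : ℕ, S ∩ Ioo (-(n : ℝ)) n := by
    ext x
    simp only [mem_iUnion, mem_inter_iff, mem_Ioo]
    refine ⟨fun hx => ?_, fun ⟨_, hx, _⟩ => hx⟩
    obtain ⟨n, hn⟩ := exists_nat_gt |x|
    exact ⟨n, hx, abs_lt.1 hn⟩
  rw [h]
  exact countable_iUnion fun n => (hS _ _).countable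

/-- The points of a set, each listed with its multiplicity. -/
def multiPoint (Λ : Set ℝ) (m : ℝ → ℕ) (i : Σ γ : Λ, Fin (m γ)) : ℝ := i.1

lemma sum_natCast_smul_dirac (Λ : Set ℝ) (m : ℝ → ℕ) :
    (Measure.sum fun γ : Λ => (m (γ : ℝ) : ℝ≥0∞) • Measure.dirac (γ : ℝ)) =
      Measure.sum fun i => Measure.dirac (multiPoint Λ m i) := by
  ext s hs
  rw [Measure.sum_apply _ hs, Measure.sum_apply _ hs, ENNReal.tsum_sigma']
  refine tsum_congr fun γ => ?_
  simp [multiPoint]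

lemma natCard_multiPoint_fiber (Λ : Set ℝ) (m : ℝ → ℕ) {x : ℝ} (hx : x ∈ Λ) :
    Nat.card {i // multiPoint Λ m i = x} = m x := by
  have e : {i // multiPoint Λ m i = x} ≃ Fin (m x) :=
    (Equiv.subtypeEquivRight fun i => by
      rw [multiPoint, ← Subtype.coe_inj (b := (⟨x, hx⟩ : Λ))]).trans
      (Equiv.sigmaSubtype (β := fun γ : Λ => Fin (m γ)) ⟨x, hx⟩)
  rw [Nat.card_congr e, Nat.card_fin]

lemma exists_eq_multiPoint {Λ : Set ℝ} {m : ℝ → ℕ} (hm : ∀ γ ∈ Λ, 0 < m γ) {x : ℝ} :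
    (∃ i, x = multiPoint Λ m i) ↔ x ∈ Λ := by
  constructor
  · rintro ⟨i, rfl⟩
    exact i.1.2
  · exact fun hx => ⟨⟨⟨x, hx⟩, ⟨0, hm x hx⟩⟩, rfl⟩

/-- A nonnegative FS-pair whose measure is a sum of unit masses satisfies the summation formula
over these masses. -/
lemma IsFSPair.poissonSum {μ : CMeasure} {a : ℝ → ℂ} (hFS : IsFSPair μ a) (hpos : μ.Nonneg)
    {ι : Type*} {g : ι → ℝ} (hν : μ.ν = Measure.sum fun i => Measure.dirac (g i)) :
    PoissonSum g a := by
  intro φ hφ hc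
  have hF : (FT φ) = fun t => SchwartzMap.fourierTransformCLM ℂ (hc.toSchwartzMap hφ) t := by
    funext t
    rw [FT_eq_fourier]
    rfl
  have hint : Integrable (FT φ) μ.ν := by
    rw [hF]
    exact hFS.1 _
  have h1 : μ.integral (FT φ) = ∫ t, FT φ t ∂μ.ν :=
    integral_congr_ae (hpos.mono fun t ht => by simp [ht])
  rw [← hFS.2.2 φ hφ hc, h1]
  rw [hν] at hint ⊢
  have h2 := hasSum_integral_measure hint
  simpa only [integral_dirac] using h2

lemma ZeroMult.mul {f h : ℂ → ℂ} {γ : ℝ} {n : ℕ} (hf : ZeroMult f γ n)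
    (hh : AnalyticAt ℂ h γ) (h0 : h γ ≠ 0) : ZeroMult (fun z => f z * h z) γ n := by
  obtain ⟨g, hg, hg0, hfg⟩ := hf
  refine ⟨fun z => g z * h z, hg.mul hh, mul_ne_zero hg0 h0, hfg.mono fun z hz => ?_⟩
  simp only [hz, mul_assoc]

lemma PoissonSum.exists_trigPoly {ι : Type*} [Countable ι] {g : ι → ℝ} {a : ℝ → ℂ}
    (h : PoissonSum g a) (hsa : LocFinSet (Function.support a)) (hgrow : ExpGrowth a) :
    ∃ Q : ℂ → ℂ, IsTrigPoly Q ∧ (∀ x : ℝ, (Q x).im = 0) ∧ (∀ z, Q z = 0 ↔ ∃ i, z = g i) ∧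
      ∀ x : ℝ, ZeroMult Q x (Nat.card {i // g i = x}) := by
  have hpi := Real.pi_pos
  obtain ⟨d, hd, ha⟩ := hgrow
  obtain ⟨δ, hδ, hgap⟩ := hsa.exists_gap
  have hs := h.summable_inv_one_add_sq hsa
  obtain ⟨c, hc⟩ : ∃ c, c ∉ range g := by
    by_contra! hall
    exact Cardinal.not_countable_real (by rw [← eq_univ_of_forall hall]; exact countable_range g)
  have hgc : ∀ i, g i ≠ c := fun i hi => hc ⟨i, hi⟩
  have hs' := summable_inv_sub_sq hs c
  obtain ⟨C, K, hCK⟩ := h.exists_exp_repr hs hgc hd ha hδ hgap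
  set S := 3 * ∑' i, ((g i - c) ^ 2)⁻¹ with hS
  have hS0 : 0 ≤ S := mul_nonneg (by norm_num) (tsum_nonneg fun i => by positivity)
  set u : ℂ → ℂ := fun z => Complex.exp (-(K.re : ℂ) * z) with hu
  have hud : Differentiable ℂ u := by fun_prop
  set Q : ℂ → ℂ := fun z => canonProd g c z * u z with hQ
  have hQd : Differentiable ℂ Q := (differentiable_canonProd hs').mul hud
  have hconj : ∀ z, Q (starRingEnd ℂ z) = starRingEnd ℂ (Q z) := fun z => by
    simp only [hQ, hu, canonProd_conj hs', map_mul, ← Complex.exp_conj, map_neg,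
      Complex.conj_ofReal]
  have hgr : ∀ z, ‖Q z‖ ≤ Real.exp (2 * S * c ^ 2 + |K.re|) *
      Real.exp ((2 * S + |K.re|) * ‖z‖ ^ 2) := fun z => by
    have h1 : ‖u z‖ ≤ Real.exp (|K.re| * ‖z‖) := by
      rw [hu, Complex.norm_exp, Real.exp_le_exp]
      refine (Complex.re_le_norm _).trans_eq ?_
      rw [norm_mul, norm_neg, Complex.norm_real, Real.norm_eq_abs]
    rw [hQ, norm_mul]
    refine (mul_le_mul (norm_canonProd_le hs' z) h1 (norm_nonneg _) (Real.exp_nonneg _)).trans ?_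
    rw [← Real.exp_add, ← Real.exp_add, Real.exp_le_exp]
    have h2 : ‖z - c‖ ≤ ‖z‖ + |c| := by
      simpa only [Complex.norm_real, Real.norm_eq_abs] using norm_sub_le z (c : ℂ)
    have h3 : ‖z - c‖ ^ 2 ≤ 2 * ‖z‖ ^ 2 + 2 * c ^ 2 := by
      have := pow_le_pow_left₀ (norm_nonneg _) h2 2
      nlinarith [sq_nonneg (‖z‖ - |c|), sq_abs c]
    have h4 : ‖z‖ ≤ 1 + ‖z‖ ^ 2 := by nlinarith [sq_nonneg (‖z‖ - 1), norm_nonneg z]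
    have h5 := mul_le_mul_of_nonneg_left h3 hS0
    have h6 := mul_le_mul_of_nonneg_left h4 (abs_nonneg K.re)
    linarith
  have hprim := summable_primCoeff ha hδ hgap
  have hprim_ge : ∀ l, primCoeff a l ≠ 0 → δ ≤ l := fun l hl => by
    obtain ⟨h1, h2⟩ := primCoeff_ne_zero hl
    simpa only [abs_of_pos h2] using hgap l h1 h2.ne'
  have hprim_fin : LocFinSet (Function.support (primCoeff a)) := fun x y =>
    (hsa x y).subset (inter_subset_inter_left _ fun l hl => (primCoeff_ne_zero hl).1)
  set Y := d / (2 * Real.pi) + 1 with hY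
  have hYd : d ≤ 2 * Real.pi * Y := by
    have : 2 * Real.pi * Y = d + 2 * Real.pi := by rw [hY]; field_simp
    linarith
  have hY0 : 0 < Y := by positivity
  have hspan : Q ∈ trigSpan univ := by
    refine mem_trigSpan_of_trigApprox (E := fun z => Complex.exp (∑' l, primCoeff a l * freq l z))
      (β := K.im / (2 * Real.pi)) (C := C) hQd hconj hY0
      (by positivity : 0 ≤ 2 * S + |K.re|) (fun z _ => hgr z) (fun z hz => ?_) fun W hW => ?_
    · have h1 : freq (K.im / (2 * Real.pi)) z = Complex.exp (K * z) * u z := by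
        rw [freq, hu, ← Complex.exp_add]
        congr 1
        have hK : K = K.re + K.im * Complex.I := (Complex.re_add_im K).symm
        have hpi' : (Real.pi : ℂ) ≠ 0 := by exact_mod_cast hpi.ne'
        push_cast
        field_simp
        linear_combination -z * hK
      simp only [hQ]
      rw [hCK z (by linarith), h1]
      ring
    · exact (TrigApprox.tsum hprim (fun l hl => hδ.le.trans (hprim_ge l hl)) hprim_fin hYd).cexp hW
        hY0.le hδ fun z hz => norm_tsum_freq_le hprim hprim_ge
          (hYd.trans (mul_le_mul_of_nonneg_left hz (by positivity)))
  refine ⟨Q, isTrigPoly_of_mem_trigSpan hspan, fun x => ?_, fun z => ?_, fun x => ?_⟩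
  · rw [← Complex.conj_eq_iff_im, ← hconj, Complex.conj_ofReal]
  · simp only [hQ, hu, mul_eq_zero, Complex.exp_ne_zero, or_false]
    exact canonProd_eq_zero hgc hs' z
  · exact (zeroMult_canonProd hgc hs' x).mul (hud.analyticAt _) (Complex.exp_ne_zero _)

/-- Remark 3.3 (Olevskii–Ulanovskii): an ℕ-valued nonnegative FS-pair with locally finite
spectrum and exponential growth comes from a real-rooted trigonometric polynomial. -/
theorem stmt10 (μ : CMeasure) (a : ℝ → ℂ) (hFS : IsFSPair μ a)
    (hN : μ.NValued) (hsa : LocFinSet (Function.support a)) (hgrow : ExpGrowth a) :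
    ∃ Q : ℂ → ℂ, IsTrigPoly Q ∧ (∀ x : ℝ, (Q (x : ℂ)).im = 0) ∧
      (∀ z : ℂ, Q z = 0 → z.im = 0) ∧
      ∃ m : ℝ → ℕ, (∀ γ : ℝ, Q (γ : ℂ) = 0 → ZeroMult Q γ (m γ)) ∧
        μ.ν = Measure.sum fun γ : {x : ℝ // Q (x : ℂ) = 0} =>
          (m (γ : ℝ) : ℝ≥0∞) • Measure.dirac (γ : ℝ) := by
  obtain ⟨hpos, Λ, m, hΛ, hm, hν⟩ := hN
  have : Countable Λ := hΛ.countable.to_subtype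
  have hsum := hFS.poissonSum hpos (hν.trans (sum_natCast_smul_dirac Λ m))
  obtain ⟨Q, hQt, hQr, hQz, hQm⟩ := hsum.exists_trigPoly hsa hgrow
  have hzero : ∀ x : ℝ, Q x = 0 ↔ x ∈ Λ := fun x => by
    rw [hQz, ← exists_eq_multiPoint hm]
    simp only [Complex.ofReal_inj]
  refine ⟨Q, hQt, hQr, fun z hz => ?_, m, fun γ hγ => ?_, ?_⟩
  · obtain ⟨i, rfl⟩ := (hQz z).1 hz
    exact Complex.ofReal_im _
  · rw [← natCard_multiPoint_fiber Λ m ((hzero γ).1 hγ)]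
    exact hQm γ
  · rw [hν]
    ext s hs
    rw [Measure.sum_apply _ hs, Measure.sum_apply _ hs]
    exact ((Equiv.subtypeEquivRight hzero).tsum_eq fun γ : Λ =>
      ((m (γ : ℝ) : ℝ≥0∞) • Measure.dirac (γ : ℝ)) s).symm
end
end

section
/- For any f ∈ AP(ℝ) and any ε > 0 there exists a trigonometric polynomial p(x) = Σ_{n=1}^{N} a_n e^{2πiλ_n x} (with a_n ∈ ℂ, λ_n ∈ ℝ) such that sup_{x∈ℝ} |f(x) − p(x)| < ε. -/
open MeasureTheory Complex Filter Topology Set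
open scoped ENNReal

noncomputable section

/-- Orthogonality of the characters of `ℤ / N`, sampled at the `N`-th division points. -/
lemma sum_fourier_division_points {N : ℕ} {m : ℤ} (hm : |m| < N) :
    ∑ k ∈ Finset.range N, fourier m (((k / N : ℝ)) : UnitAddCircle) =
      if m = 0 then (N : ℂ) else 0 := by
  have hN : N ≠ 0 := by
    rintro rfl
    exact absurd hm (not_lt.mpr (by simp))
  have hζ := Complex.isPrimitiveRoot_exp N hN
  set ζ := Complex.exp (2 * Real.pi * Complex.I / N) with hζdef
  have hterm (k : ℕ) : fourier m (((k / N : ℝ)) : UnitAddCircle) = (ζ ^ m) ^ k := by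
    rw [fourier_coe_apply, hζdef, ← Complex.exp_int_mul, ← Complex.exp_nat_mul]
    congr 1
    push_cast
    ring
  simp_rw [hterm]
  split_ifs with h
  · simp [h]
  · have hne : ζ ^ m ≠ 1 := fun h1 =>
      h (Int.eq_zero_of_abs_lt_dvd ((hζ.zpow_eq_one_iff_dvd m).1 h1) hm)
    have hpow : (ζ ^ m) ^ N = 1 := by
      rw [← zpow_natCast, ← zpow_mul, mul_comm, zpow_mul, zpow_natCast, hζ.pow_eq_one, one_zpow]
    have := mul_geom_sum (ζ ^ m) N
    rw [hpow, sub_self] at this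
    exact (mul_eq_zero.1 this).resolve_left (sub_ne_zero.2 hne)

lemma re_fourier_nonneg {m : ℤ} {x : UnitAddCircle} (h : ‖m • x‖ < 1 / 4) :
    0 ≤ (fourier m x : ℂ).re := by
  have h1 : (fourier m x : ℂ) = fourier 1 (m • x) := by simp [fourier_apply]
  rw [h1]
  generalize m • x = y at h
  induction y using QuotientAddGroup.induction_on with
  | H r =>
    have h2 : ((r : ℝ) : UnitAddCircle) = ((r - round r : ℝ) : UnitAddCircle) := by
      rw [AddCircle.coe_sub, eq_comm, sub_eq_self]
      exact AddCircle.coe_eq_zero_iff 1 |>.2 ⟨round r, by simp⟩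
    change ‖((r : ℝ) : UnitAddCircle)‖ < 1 / 4 at h
    change 0 ≤ (fourier 1 ((r : ℝ) : UnitAddCircle) : ℂ).re
    rw [UnitAddCircle.norm_eq, abs_lt] at h
    rw [h2, fourier_coe_apply]
    have h3 : (2 * Real.pi * Complex.I * (1 : ℤ) * ((r - round r : ℝ) : ℂ) / (1 : ℝ) : ℂ) =
        ((2 * Real.pi * (r - round r) : ℝ) : ℂ) * Complex.I := by
      push_cast
      ring
    rw [h3, Complex.exp_ofReal_mul_I_re]
    apply Real.cos_nonneg_of_mem_Icc
    have := Real.pi_pos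
    constructor <;> nlinarith

/-- A finite set of cardinality at most `K` is covered by the range of a function on `Fin K`. -/
lemma Finset.exists_fin_cover {α : Type*} [Inhabited α] (s : Finset α) {K : ℕ} (h : s.card ≤ K) :
    ∃ x : Fin K → α, ∀ a ∈ s, ∃ j, x j = a := by
  refine ⟨fun j => if hj : (j : ℕ) < s.card then s.equivFin.symm ⟨j, hj⟩ else default,
    fun a ha => ⟨⟨s.equivFin ⟨a, ha⟩, (s.equivFin ⟨a, ha⟩).2.trans_le h⟩, ?_⟩⟩
  simp

/-- Finite form of **Bogolyubov's lemma**: for a dense set `A` of integers in an interval,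
`A + A - A - A` contains a Bohr set whose rank is bounded in terms of the density. -/
lemma exists_bohr_subset_of_finset {A : Finset ℤ} {M D : ℕ} (hA : ∀ a ∈ A, 0 ≤ a ∧ a < M)
    (hM : 0 < M) (hD : 4 * M ≤ D * A.card) :
    ∃ x : Fin (2 * D ^ 2) → UnitAddCircle, ∀ t : ℤ, |t| ≤ M → (∀ j, ‖t • x j‖ < 1 / 4) →
      ∃ a ∈ A, ∃ b ∈ A, ∃ c ∈ A, ∃ d ∈ A, t = a + b - c - d := by
  set N : ℕ := 4 * M with hN
  set S : ℕ := A.card with hS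
  have hN0 : (0 : ℝ) < N := by positivity
  have hS0 : (0 : ℝ) < S := by
    have : S ≠ 0 := by
      rintro h
      rw [h] at hD
      omega
    positivity
  let pt : ℕ → UnitAddCircle := fun k => ((k / N : ℝ) : UnitAddCircle)
  let F : ℕ → ℂ := fun k => ∑ a ∈ A, fourier a (pt k)
  have parseval : ∑ k ∈ Finset.range N, ‖F k‖ ^ 2 = N * S := by
    have h1 (k : ℕ) : ((‖F k‖ ^ 2 : ℝ) : ℂ) = ∑ a ∈ A, ∑ b ∈ A, fourier (a + -b) (pt k) := by
      push_cast
      rw [← Complex.mul_conj', map_sum, Finset.sum_mul_sum]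
      simp_rw [fourier_add, fourier_neg]
    have h2 : ((∑ k ∈ Finset.range N, ‖F k‖ ^ 2 : ℝ) : ℂ) = ((N * S : ℝ) : ℂ) := by
      rw [Complex.ofReal_sum]
      simp_rw [h1]
      rw [Finset.sum_comm]
      have h3 (a : ℤ) (ha : a ∈ A) :
          ∑ k ∈ Finset.range N, ∑ b ∈ A, fourier (a + -b) (pt k) = (N : ℂ) := by
        rw [Finset.sum_comm]
        have h4 (b : ℤ) (hb : b ∈ A) : ∑ k ∈ Finset.range N, fourier (a + -b) (pt k) =
            if b = a then (N : ℂ) else 0 := by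
          rw [sum_fourier_division_points]
          · congr 1
            rw [eq_iff_iff]
            omega
          · have := hA a ha
            have := hA b hb
            rw [abs_lt]
            omega
        rw [Finset.sum_congr rfl h4, Finset.sum_ite_eq' A a]
        simp [ha]
      rw [Finset.sum_congr rfl h3]
      simp [hS, mul_comm]
    exact_mod_cast h2
  let Λ : Finset ℕ := (Finset.range N).filter fun k => (S : ℝ) ^ 3 ≤ 2 * N * ‖F k‖ ^ 2
  have hΛ : Λ.card ≤ 2 * D ^ 2 := by
    have h1 : (Λ.card : ℝ) * S ^ 3 ≤ 2 * N * (N * S) := by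
      calc (Λ.card : ℝ) * S ^ 3 = ∑ k ∈ Λ, (S : ℝ) ^ 3 := by simp
        _ ≤ ∑ k ∈ Λ, 2 * N * ‖F k‖ ^ 2 :=
          Finset.sum_le_sum fun k hk => (Finset.mem_filter.1 hk).2
        _ ≤ ∑ k ∈ Finset.range N, 2 * N * ‖F k‖ ^ 2 :=
          Finset.sum_le_sum_of_subset_of_nonneg (Finset.filter_subset _ _)
            fun _ _ _ => by positivity
        _ = _ := by rw [← Finset.mul_sum, parseval]
    have h2 : (N : ℝ) ≤ D * S := by exact_mod_cast hD
    have h3 : (Λ.card : ℝ) * S ^ 3 ≤ (2 * D ^ 2) * S ^ 3 := by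
      have : (N : ℝ) ^ 2 ≤ (D * S) ^ 2 := by gcongr
      nlinarith
    have h4 := le_of_mul_le_mul_right h3 (by positivity)
    exact_mod_cast h4
  obtain ⟨x, hx⟩ := (Λ.image pt).exists_fin_cover (Finset.card_image_le.trans hΛ)
  refine ⟨x, fun t ht hxt => ?_⟩
  by_contra! hno
  have hzero : ∑ k ∈ Finset.range N, ((‖F k‖ ^ 4 : ℝ) : ℂ) * fourier (-t) (pt k) = 0 := by
    have h1 (k : ℕ) : ((‖F k‖ ^ 4 : ℝ) : ℂ) * fourier (-t) (pt k) =
        ∑ a ∈ A, ∑ b ∈ A, ∑ c ∈ A, ∑ d ∈ A, fourier (a + b + -c + -d + -t) (pt k) := by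
      have : ((‖F k‖ ^ 4 : ℝ) : ℂ) =
          F k * F k * (starRingEnd ℂ) (F k) * (starRingEnd ℂ) (F k) := by
        calc ((‖F k‖ ^ 4 : ℝ) : ℂ) = ((‖F k‖ : ℂ) ^ 2) ^ 2 := by push_cast; ring
          _ = _ := by rw [← Complex.mul_conj']; ring
      rw [this]
      simp only [F, fourier_add, fourier_neg, ← Finset.sum_mul, ← Finset.mul_sum, ← map_sum]
    simp_rw [h1]
    rw [Finset.sum_comm]
    refine Finset.sum_eq_zero fun a ha => ?_
    rw [Finset.sum_comm]
    refine Finset.sum_eq_zero fun b hb => ?_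
    rw [Finset.sum_comm]
    refine Finset.sum_eq_zero fun c hc => ?_
    rw [Finset.sum_comm]
    refine Finset.sum_eq_zero fun d hd => ?_
    have := hno a ha b hb c hc d hd
    have := hA a ha
    have := hA b hb
    have := hA c hc
    have := hA d hd
    rw [sum_fourier_division_points, if_neg (by omega)]
    rw [abs_le] at ht
    rw [abs_lt]
    omega
  have hlower (k : ℕ) (hk : k ∈ Finset.range N) :
      (if k = 0 then (S : ℝ) ^ 4 else 0) - S ^ 3 / (2 * N) * ‖F k‖ ^ 2 ≤
        (((‖F k‖ ^ 4 : ℝ) : ℂ) * fourier (-t) (pt k)).re := by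
    rw [Complex.re_ofReal_mul]
    split_ifs with h0
    · have h1 : ‖F k‖ = S := by simp [F, pt, h0, hS]
      have h2 : (fourier (-t) (pt k) : ℂ) = 1 := by simp [pt, h0]
      rw [h1, h2, Complex.one_re, mul_one, sub_le_self_iff]
      positivity
    · by_cases hkΛ : k ∈ Λ
      · obtain ⟨j, hj⟩ := hx _ (Finset.mem_image_of_mem pt hkΛ)
        have h1 : 0 ≤ (fourier (-t) (pt k) : ℂ).re := by
          apply re_fourier_nonneg
          rw [neg_smul, norm_neg, ← hj]
          exact hxt j
        have : 0 ≤ (S : ℝ) ^ 3 / (2 * N) * ‖F k‖ ^ 2 := by positivity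
        have : 0 ≤ ‖F k‖ ^ 4 * (fourier (-t) (pt k) : ℂ).re := by positivity
        linarith
      · have h1 : 2 * N * ‖F k‖ ^ 2 ≤ (S : ℝ) ^ 3 := by
          by_contra! h
          exact hkΛ (Finset.mem_filter.2 ⟨hk, h.le⟩)
        have h2 : ‖F k‖ ^ 2 ≤ (S : ℝ) ^ 3 / (2 * N) := by
          rw [le_div_iff₀ (by positivity)]
          linarith
        have h3 : -1 ≤ (fourier (-t) (pt k) : ℂ).re := by
          have h4 := Complex.abs_re_le_norm (fourier (-t) (pt k) : ℂ)
          rw [fourier_apply, Circle.norm_coe, abs_le] at h4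
          exact h4.1
        have h5 : ‖F k‖ ^ 4 ≤ (S : ℝ) ^ 3 / (2 * N) * ‖F k‖ ^ 2 := by
          calc ‖F k‖ ^ 4 = ‖F k‖ ^ 2 * ‖F k‖ ^ 2 := by ring
            _ ≤ _ := by gcongr
        have : 0 ≤ ‖F k‖ ^ 4 := by positivity
        nlinarith
  have hsum := Finset.sum_le_sum hlower
  rw [← Complex.re_sum, hzero, Finset.sum_sub_distrib, ← Finset.mul_sum, parseval,
    Finset.sum_ite_eq' (Finset.range N) 0, if_pos (Finset.mem_range.2 (by omega)),
    Complex.zero_re] at hsum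
  have h1 : (S : ℝ) ^ 3 / (2 * N) * (N * S) = S ^ 4 / 2 := by
    field_simp
  have : (0 : ℝ) < (S : ℝ) ^ 4 := by positivity
  linarith

/-- **Bogolyubov's lemma** for relatively dense (syndetic) sets of integers. -/
lemma exists_bohr_subset_of_syndetic {E : Set ℤ} {L : ℕ}
    (hE : ∀ n : ℤ, ∃ e ∈ E, n ≤ e ∧ e < n + L) :
    ∃ (K : ℕ) (x : Fin K → UnitAddCircle), ∀ t : ℤ, (∀ j, ‖t • x j‖ < 1 / 4) →
      ∃ a ∈ E, ∃ b ∈ E, ∃ c ∈ E, ∃ d ∈ E, t = a + b - c - d := by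
  classical
  choose g hgE hg hg' using hE
  have hL : 0 < L := by
    have := hg 0
    have := hg' 0
    omega
  let A : ℕ → Finset ℤ := fun m => (Finset.Ico (0 : ℤ) (L * (m + 1) : ℕ)).filter (· ∈ E)
  have hcard (m : ℕ) : m + 1 ≤ (A m).card := by
    have := Finset.card_le_card_of_injOn (s := Finset.range (m + 1)) (t := A m)
      (fun i => g (L * i)) ?_ ?_
    · simpa using this
    · intro i hi
      have h1 : i < m + 1 := by simpa using hi
      have h2 := hg (L * i)
      have h3 := hg' (L * i)
      have h4 : (L : ℤ) * (i + 1) ≤ L * (m + 1) := by gcongr; omega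
      have h5 : (0 : ℤ) ≤ L * i := by positivity
      simp only [A, Finset.coe_filter, Finset.mem_Ico, Set.mem_ofPred_eq]
      refine ⟨⟨by linarith, ?_⟩, hgE _⟩
      push_cast
      linarith
    · have key (i j : ℕ) (h : g (L * i) = g (L * j)) : i ≤ j := by
        by_contra! hij
        have h1 := hg (L * i)
        have h2 := hg' (L * j)
        have h4 : (L : ℤ) * (j + 1) ≤ L * i := by gcongr; omega
        linarith
      intro i _ j _ h
      exact le_antisymm (key i j h) (key j i h.symm)
  have hfin (m : ℕ) := exists_bohr_subset_of_finset (A := A m) (M := L * (m + 1)) (D := 4 * L)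
    (fun a ha => by simpa using (Finset.mem_filter.1 ha).1) (by positivity)
    (by nlinarith [hcard m])
  choose x hx using hfin
  obtain ⟨y, φ, hφ, hy⟩ := CompactSpace.tendsto_subseq x
  refine ⟨_, y, fun t ht => ?_⟩
  have hev : ∀ᶠ n in atTop, ∀ j, ‖t • x (φ n) j‖ < 1 / 4 := by
    rw [eventually_all]
    intro j
    have h1 : Tendsto (fun n => ‖t • x (φ n) j‖) atTop (𝓝 ‖t • y j‖) :=
      (((tendsto_pi_nhds.1 hy) j).const_smul t).norm
    exact h1.eventually_lt_const (ht j)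
  obtain ⟨n, hn, hnt⟩ := (hev.and (eventually_ge_atTop t.natAbs)).exists
  have hbig : |t| ≤ ((L * (φ n + 1) : ℕ) : ℤ) := by
    rw [Int.abs_eq_natAbs]
    have := hφ.id_le n
    have h2 : t.natAbs ≤ φ n := hnt.trans this
    exact_mod_cast h2.trans (by nlinarith)
  obtain ⟨a, ha, b, hb, c, hc, d, hd, h⟩ := hx (φ n) t hbig hn
  exact ⟨a, (Finset.mem_filter.1 ha).2, b, (Finset.mem_filter.1 hb).2,
    c, (Finset.mem_filter.1 hc).2, d, (Finset.mem_filter.1 hd).2, h⟩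

/-- The `ε`-almost periods of `f`. -/
def almostPeriods (f : ℝ → ℂ) (ε : ℝ) : Set ℝ := {t | ∀ x, ‖f x - f (x + t)‖ ≤ ε}

lemma almostPeriods_add {f : ℝ → ℂ} {ε η s t : ℝ} (hs : s ∈ almostPeriods f ε)
    (ht : t ∈ almostPeriods f η) : s + t ∈ almostPeriods f (ε + η) := fun x => by
  rw [← add_assoc]
  exact (norm_sub_le_norm_sub_add_norm_sub _ _ _).trans (add_le_add (hs x) (ht (x + s)))

lemma almostPeriods_neg {f : ℝ → ℂ} {ε t : ℝ} (ht : t ∈ almostPeriods f ε) :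
    -t ∈ almostPeriods f ε := fun x => by
  have := ht (x + -t)
  rwa [neg_add_cancel_right, norm_sub_rev] at this

lemma APR.exists_small_almostPeriods {f : ℝ → ℂ} (hf : APR f) {ε : ℝ} (hε : 0 < ε) :
    ∃ δ > 0, ∀ s, |s| ≤ δ → s ∈ almostPeriods f ε := by
  obtain ⟨l, hl, hdense⟩ := hf.2 (ε / 3) (by positivity)
  have huc := (isCompact_Icc (a := (-1 : ℝ)) (b := l + 1)).uniformContinuousOn_of_continuous
    hf.1.continuousOn
  rw [Metric.uniformContinuousOn_iff_le] at huc
  obtain ⟨δ, hδ, h⟩ := huc (ε / 3) (by positivity)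
  refine ⟨min δ 1, by positivity, fun s hs x => ?_⟩
  obtain ⟨t, ht, h1, h2⟩ := hdense (-x)
  have hs1 := abs_le.1 (hs.trans (min_le_right _ _))
  have h3 := h (x + t) ⟨by linarith, by linarith⟩ (x + s + t) ⟨by linarith, by linarith⟩ (by
    rw [Real.dist_eq, show x + t - (x + s + t) = -s by ring, abs_neg]
    exact hs.trans (min_le_left _ _))
  rw [dist_eq_norm] at h3
  have h4 := ht x
  have h5 := ht (x + s)
  rw [norm_sub_rev] at h5
  have h6 := norm_sub_le_norm_sub_add_norm_sub (f x) (f (x + t)) (f (x + s))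
  have h7 := norm_sub_le_norm_sub_add_norm_sub (f (x + t)) (f (x + s + t)) (f (x + s))
  linarith

/-- An almost periodic function is uniformly continuous for the Bohr topology. -/
lemma APR.exists_bohr_almostPeriods {f : ℝ → ℂ} (hf : APR f) {ε : ℝ} (hε : 0 < ε) :
    ∃ (K : ℕ) (lam : Fin K → ℝ), ∀ t : ℝ,
      (∀ i, ‖((lam i * t : ℝ) : UnitAddCircle)‖ < 1 / 8) → t ∈ almostPeriods f ε := by
  set η := ε / 9 with hη
  have hη0 : 0 < η := by positivity
  obtain ⟨δ, hδ, hsmall⟩ := hf.exists_small_almostPeriods hη0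
  obtain ⟨l, hl, hdense⟩ := hf.2 η hη0
  let E : Set ℤ := {n | (n * δ : ℝ) ∈ almostPeriods f (η + η)}
  have hE (n : ℤ) : ∃ e ∈ E, n ≤ e ∧ e < n + (⌈l / δ⌉₊ + 1 : ℕ) := by
    obtain ⟨t, ht, h1, h2⟩ := hdense (n * δ)
    refine ⟨⌊t / δ⌋, ?_, ?_, ?_⟩
    · have h3 : (⌊t / δ⌋ * δ : ℝ) = t + -(Int.fract (t / δ) * δ) := by
        rw [Int.fract]
        field_simp
        ring
      change (⌊t / δ⌋ * δ : ℝ) ∈ almostPeriods f (η + η)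
      rw [h3]
      refine almostPeriods_add ht (almostPeriods_neg (hsmall _ ?_))
      rw [abs_of_nonneg (mul_nonneg (Int.fract_nonneg _) hδ.le)]
      nlinarith [Int.fract_lt_one (t / δ)]
    · rw [Int.le_floor, le_div_iff₀ hδ]
      exact h1.le
    · rw [Int.floor_lt]
      push_cast
      have h3 : t / δ < n + l / δ := by
        rw [div_lt_iff₀ hδ, add_mul, div_mul_cancel₀ _ hδ.ne']
        exact h2
      have := Nat.le_ceil (l / δ)
      linarith
  obtain ⟨K, x, hx⟩ := exists_bohr_subset_of_syndetic hE
  have hrep (y : UnitAddCircle) : ∃ r : ℝ, (r : UnitAddCircle) = y ∧ |r| ≤ 1 / 2 := by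
    induction y using QuotientAddGroup.induction_on with
    | H r =>
      refine ⟨r - round r, ?_, abs_sub_round r⟩
      rw [AddCircle.coe_sub]
      exact sub_eq_self.2 (AddCircle.coe_eq_zero_iff 1 |>.2 ⟨round r, by simp⟩)
  choose θ hθ hθ' using fun j => hrep (x j)
  refine ⟨K + 1, Fin.cons (1 / δ) fun j => θ j / δ, fun t ht => ?_⟩
  have ht0 := ht 0
  rw [Fin.cons_zero, UnitAddCircle.norm_eq] at ht0
  set n := round (1 / δ * t) with hn
  set s := 1 / δ * t - n with hs
  have hts : t = n * δ + s * δ := by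
    rw [hs]
    field_simp
    ring
  have hbohr (j : Fin K) : ‖n • x j‖ < 1 / 4 := by
    have h1 := ht j.succ
    rw [Fin.cons_succ] at h1
    have h2 : n • x j = ((θ j / δ * t : ℝ) : UnitAddCircle) - ((θ j * s : ℝ) : UnitAddCircle) := by
      rw [← hθ j, ← AddCircle.coe_zsmul, ← AddCircle.coe_sub]
      congr 1
      rw [hs, zsmul_eq_mul]
      ring
    have h3 : ‖((θ j * s : ℝ) : UnitAddCircle)‖ ≤ |θ j * s| := by
      rw [UnitAddCircle.norm_eq]
      simpa using round_le (θ j * s) 0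
    rw [abs_mul] at h3
    have h4 : |θ j| * |s| ≤ 1 / 2 * (1 / 8) :=
      mul_le_mul (hθ' j) ht0.le (abs_nonneg _) (by norm_num)
    rw [h2]
    have := norm_sub_le ((θ j / δ * t : ℝ) : UnitAddCircle) ((θ j * s : ℝ) : UnitAddCircle)
    linarith
  obtain ⟨a, ha, b, hb, c, hc, d, hd, habcd⟩ := hx n hbohr
  have hsδ : s * δ ∈ almostPeriods f η := hsmall _ (by
    rw [abs_mul, abs_of_pos hδ]
    nlinarith)
  have hnδ := almostPeriods_add (almostPeriods_add (almostPeriods_add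
    (almostPeriods_add ha hb) (almostPeriods_neg hc)) (almostPeriods_neg hd)) hsδ
  convert hnδ using 1
  · rw [hη]
    ring_nf
  · rw [hts, habcd]
    push_cast
    ring

/-- A trigonometric polynomial on a torus, restricted to a one-parameter subgroup, is a
trigonometric polynomial on the line. -/
lemma exists_trigPoly_of_mem_span_mFourier {ι : Type*} [Fintype ι] (lam : ι → ℝ)
    {P : C(UnitAddTorus ι, ℂ)}
    (hP : P ∈ Submodule.span ℂ (range (UnitAddTorus.mFourier (d := ι)))) :
    ∃ (N : ℕ) (p : Fin N → ℂ) (θ : Fin N → ℝ), ∀ x : ℝ,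
      P (fun i => ((lam i * x : ℝ) : UnitAddCircle)) =
        ∑ n, p n * Complex.exp (2 * (Real.pi : ℂ) * Complex.I * (θ n : ℂ) * (x : ℂ)) := by
  obtain ⟨c, rfl⟩ := Finsupp.mem_span_range_iff_exists_finsupp.1 hP
  let e := c.support.equivFin
  refine ⟨_, fun n => c (e.symm n), fun n => ∑ i, (e.symm n : ι → ℤ) i * lam i, fun x => ?_⟩
  rw [e.symm.sum_comp fun m : c.support => c m * Complex.exp
    (2 * (Real.pi : ℂ) * Complex.I * ((∑ i, (m : ι → ℤ) i * lam i : ℝ) : ℂ) * (x : ℂ)),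
    Finsupp.sum, ContinuousMap.sum_apply, ← Finset.sum_coe_sort]
  refine Finset.sum_congr rfl fun m _ => ?_
  rw [ContinuousMap.smul_apply, smul_eq_mul]
  congr 1
  simp only [UnitAddTorus.mFourier, ContinuousMap.coe_mk, fourier_coe_apply]
  rw [← Complex.exp_sum]
  congr 1
  push_cast
  rw [Finset.mul_sum, Finset.sum_mul]
  refine Finset.sum_congr rfl fun i _ => ?_
  ring

/-- Lemma 4.2: almost periodic functions are uniform limits of trigonometric polynomials. -/
theorem stmt11 (f : ℝ → ℂ) (hf : APR f) (ε : ℝ) (hε : 0 < ε) :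
    ∃ (N : ℕ) (p : Fin N → ℂ) (θ : Fin N → ℝ), ∀ x : ℝ,
      ‖f x - ∑ n, p n * Complex.exp (2 * (Real.pi : ℂ) * Complex.I * (θ n : ℂ) * (x : ℂ))‖
        < ε := by
  obtain ⟨K, lam, hlam⟩ := hf.exists_bohr_almostPeriods (half_pos (half_pos hε))
  let φ : ℝ → UnitAddTorus (Fin K) := fun x i => ((lam i * x : ℝ) : UnitAddCircle)
  have hclose (x y : ℝ) (h : dist (φ x) (φ y) < 1 / 8) : ‖f x - f y‖ ≤ ε / 2 / 2 := by
    have := hlam (y - x) (fun i => by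
      rw [mul_sub, AddCircle.coe_sub, ← dist_eq_norm, dist_comm]
      exact (dist_le_pi_dist (φ x) (φ y) i).trans_lt h) x
    rwa [add_sub_cancel] at this
  obtain ⟨G, hG⟩ := exists_continuous_forall_mem_convex_of_local_const
    (t := fun u : UnitAddTorus (Fin K) =>
      {z : ℂ | ∀ x, φ x = u → z ∈ Metric.closedBall (f x) (ε / 2 / 2)})
    (fun u => by
      simp only [ofPred_forall]
      exact convex_iInter fun x => convex_iInter fun _ => convex_closedBall _ _)
    (fun u => by
      by_cases h : ∃ x₀, dist (φ x₀) u < 1 / 16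
      · obtain ⟨x₀, hx₀⟩ := h
        refine ⟨f x₀, ?_⟩
        filter_upwards [Metric.ball_mem_nhds u (by norm_num : (0 : ℝ) < 1 / 16)] with v hv x hx
        rw [Metric.mem_ball, dist_comm] at hv
        rw [mem_closedBall_iff_norm]
        apply hclose
        rw [hx]
        linarith [dist_triangle (φ x₀) u v]
      · refine ⟨0, ?_⟩
        filter_upwards [Metric.ball_mem_nhds u (by norm_num : (0 : ℝ) < 1 / 16)] with v hv x hx
        exact absurd ⟨x, hx ▸ hv⟩ h)
  have hGcl : G ∈ closure
      (Submodule.span ℂ (range (UnitAddTorus.mFourier (d := Fin K))) : Set C(_, ℂ)) := by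
    rw [← Submodule.topologicalClosure_coe, UnitAddTorus.span_mFourier_closure_eq_top]
    trivial
  obtain ⟨P, hP, hGP⟩ := Metric.mem_closure_iff.1 hGcl (ε / 2) (half_pos hε)
  obtain ⟨N, p, θ, hp⟩ := exists_trigPoly_of_mem_span_mFourier lam hP
  refine ⟨N, p, θ, fun x => ?_⟩
  rw [← hp x, ← dist_eq_norm]
  have h1 : dist (f x) (G (φ x)) ≤ ε / 2 / 2 := by
    rw [dist_comm]
    exact hG (φ x) x rfl
  have h2 : dist (G (φ x)) (P (φ x)) ≤ dist G P := ContinuousMap.dist_apply_le_dist _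
  have h3 := dist_triangle (f x) (G (φ x)) (P (φ x))
  change dist (f x) (P (φ x)) < ε
  linarith
end
end
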